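/- Let R_5 be the pentagonal ring of five pentagons in a fullerene graph F and let 𝓗 be a Clar set of the hexagon extension H[R_5]. Then |U_𝓗(R_5)| ≥ 12. -/

import Mathlib

namespace FG

/-- A combinatorial plane (spherically embedded) graph: a finite simple graph together with
its collection of faces, each face recorded as the finset of edges of its boundary cycle.
Every face boundary is a cycle, every edge lies on exactly two faces, and Euler's formula
holds (edges are counted via the face incidences). -/
structure PlaneGraph (V : Type) [Fintype V] [DecidableEq V] : Type where
  graph : SimpleGraph V
  faces : Finset (Finset (Sym2 V))
  face_edges : ∀ f ∈ faces, ∀ e ∈ f, e ∈ graph.edgeSet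
  face_cycle : ∀ f ∈ faces, ∃ (v : V) (c : graph.Walk v v), c.IsCycle ∧ c.edges.toFinset = f
  edge_faces : ∀ e ∈ graph.edgeSet, (faces.filter (fun f => e ∈ f)).card = 2
  euler : 2 * (Fintype.card V + faces.card) = (∑ f ∈ faces, f.card) + 4

variable {V : Type} [Fintype V] [DecidableEq V]

/-- The vertices incident with at least one edge of an edge set. -/
def edgeVerts (E : Finset (Sym2 V)) : Finset V :=
  Finset.univ.filter fun v => ∃ e ∈ E, v ∈ e

/-- The degree of a vertex in the subgraph spanned by an edge set. -/
def deg (E : Finset (Sym2 V)) (v : V) : ℕ := (E.filter fun e => v ∈ e).card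

/-- The vertices covered by a collection of faces. -/
def facesVerts (H : Finset (Finset (Sym2 V))) : Finset V := edgeVerts (H.sup id)

/-- An edge set is a matching: non-loop edges, pairwise vertex-disjoint. -/
def IsMatching (M : Finset (Sym2 V)) : Prop :=
  (∀ e ∈ M, ¬e.IsDiag) ∧ ∀ e ∈ M, ∀ e' ∈ M, e ≠ e' → ∀ v : V, v ∈ e → v ∉ e'

/-- A fullerene graph: a cubic 3-connected plane graph with (exactly 12) pentagonal
faces and hexagonal faces. -/
structure IsFullerene (P : PlaneGraph V) : Prop where
  cubic : ∀ v : V, (P.graph.neighborSet v).ncard = 3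
  threeConnected : ∀ s : Set V, s.ncard ≤ 2 → (SimpleGraph.induce sᶜ P.graph).Connected
  faceSize : ∀ f ∈ P.faces, f.card = 5 ∨ f.card = 6
  pentTwelve : (P.faces.filter fun f => f.card = 5).card = 12

/-- A fragment of a plane graph: a nonempty set of faces (a cycle together with its
interior) whose boundary — the set of edges lying on exactly one chosen face — is a
single cycle. -/
structure Fragment (P : PlaneGraph V) : Type where
  inFaces : Finset (Finset (Sym2 V))
  nonempty : inFaces.Nonempty
  subFaces : inFaces ⊆ P.faces
  boundary_cycle : ∃ (v : V) (c : P.graph.Walk v v), c.IsCycle ∧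
    c.edges.toFinset =
      (inFaces.sup id).filter fun e => (inFaces.filter fun f => e ∈ f).card = 1

/-- The edge set of a fragment. -/
def Fragment.edges {P : PlaneGraph V} (B : Fragment P) : Finset (Sym2 V) := B.inFaces.sup id

/-- The boundary edges of a fragment. -/
def Fragment.boundary {P : PlaneGraph V} (B : Fragment P) : Finset (Sym2 V) :=
  B.edges.filter fun e => (B.inFaces.filter fun f => e ∈ f).card = 1

/-- A pentagonal fragment: all inner faces are pentagons. -/
def IsPentagonalFragment {P : PlaneGraph V} (B : Fragment P) : Prop :=
  ∀ f ∈ B.inFaces, f.card = 5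

/-- The faces of `P` adjoining the subgraph with edge set `E`: not a face of the
subgraph, but sharing at least one edge with it. -/
def adjoiningFaces (P : PlaneGraph V) (E : Finset (Sym2 V)) : Finset (Finset (Sym2 V)) :=
  P.faces.filter fun f => ¬f ⊆ E ∧ (f ∩ E).Nonempty

/-- The territory `T[G]` of the subgraph with edge set `E`: the subgraph together with
all adjoining faces. -/
def territoryEdges (P : PlaneGraph V) (E : Finset (Sym2 V)) : Finset (Sym2 V) :=
  E ∪ (adjoiningFaces P E).sup id

/-- `w(G)`: the number of 2-degree vertices of the subgraph spanned by `E`. -/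
def wcount (E : Finset (Sym2 V)) : ℕ := ((edgeVerts E).filter fun v => deg E v = 2).card

/-- A subgraph is maximal in `P` when its hexagon extension is contained in `P`,
i.e. every adjoining face is a hexagon. -/
def IsMaximalIn (P : PlaneGraph V) (E : Finset (Sym2 V)) : Prop :=
  ∀ f ∈ adjoiningFaces P E, f.card = 6

/-- `H ∈ 𝒮(G)` for the subgraph `G` with edge set `E`: `H` is a set of mutually disjoint
hexagons of the hexagon extension `H[G]` (hexagonal faces sharing at least one edge with
`G`) such that `G − H` has a matching covering all remaining 3-degree vertices of `G`. -/
def SextetAdm (P : PlaneGraph V) (E : Finset (Sym2 V)) (H : Finset (Finset (Sym2 V))) : Prop :=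
  (∀ f ∈ H, f ∈ P.faces ∧ f.card = 6 ∧ (f ∩ E).Nonempty) ∧
  (∀ f ∈ H, ∀ g ∈ H, f ≠ g → Disjoint (edgeVerts f) (edgeVerts g)) ∧
  ∃ M : Finset (Sym2 V), M ⊆ E ∧ IsMatching M ∧
    (∀ e ∈ M, ∀ v : V, v ∈ e → v ∉ facesVerts H) ∧
    ∀ v ∈ edgeVerts E, deg E v = 3 → v ∉ facesVerts H → ∃ e ∈ M, v ∈ e

/-- `U_H(G) = V(G) ∖ V(H)`. -/
def Uset (E : Finset (Sym2 V)) (H : Finset (Finset (Sym2 V))) : Finset V :=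
  edgeVerts E \ facesVerts H

/-- A Clar set of `H[G]`: a member of `𝒮(G)` minimizing `|U_H(G)|`. -/
def IsClarSet (P : PlaneGraph V) (E : Finset (Sym2 V)) (H : Finset (Finset (Sym2 V))) : Prop :=
  SextetAdm P E H ∧ ∀ H', SextetAdm P E H' → (Uset E H).card ≤ (Uset E H').card

/-- A normal Clar set: a Clar set such that `G − H` has a perfect matching. -/
def IsNormalClarSet (P : PlaneGraph V) (E : Finset (Sym2 V))
    (H : Finset (Finset (Sym2 V))) : Prop :=
  IsClarSet P E H ∧ ∃ M : Finset (Sym2 V), M ⊆ E ∧ IsMatching M ∧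
    (∀ e ∈ M, ∀ v : V, v ∈ e → v ∉ facesVerts H) ∧
    ∀ v ∈ Uset E H, ∃ e ∈ M, v ∈ e

/-- The pentagonal faces of the subgraph with edge set `E`. -/
def pentFaces (P : PlaneGraph V) (E : Finset (Sym2 V)) : Finset (Finset (Sym2 V)) :=
  P.faces.filter fun f => f.card = 5 ∧ f ⊆ E

/-- A subgraph with `k` pentagons is extremal if `|U_H(G)| = k` for a Clar set `H`. -/
def IsExtremalSub (P : PlaneGraph V) (E : Finset (Sym2 V)) : Prop :=
  ∃ H, IsClarSet P E H ∧ (Uset E H).card = (pentFaces P E).card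

/-- A pentagonal ring `R_k`: `k` pentagonal faces `R 0, …, R (k-1)` such that
`R i` and `R j` intersect iff `|i − j| = 1 (mod k)`. -/
def IsPentRing (P : PlaneGraph V) (k : ℕ) (R : ZMod k → Finset (Sym2 V)) : Prop :=
  Function.Injective R ∧ (∀ i, R i ∈ P.faces ∧ (R i).card = 5) ∧
  ∀ i j : ZMod k, i ≠ j →
    ((edgeVerts (R i) ∩ edgeVerts (R j)).Nonempty ↔ (j = i + 1 ∨ i = j + 1))

/-- The number of pentagons of the pentagonal fragment `B` adjoining (sharing an edge
with) the pentagon `p`. -/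
def pentAdjCount {P : PlaneGraph V} (B : Fragment P) (p : Finset (Sym2 V)) : ℕ :=
  (B.inFaces.filter fun q => q ≠ p ∧ (q ∩ p).Nonempty).card

/-- The fragment consisting of a single pentagon `P`. -/
def IsPentagonFrag {P : PlaneGraph V} (B : Fragment P) : Prop :=
  IsPentagonalFragment B ∧ B.inFaces.card = 1

/-- `B_2`: the extremal pentagonal fragment with 4 pentagons whose Clar extension is
normal. -/
def IsB2Frag {P : PlaneGraph V} (B : Fragment P) : Prop :=
  IsPentagonalFragment B ∧ B.inFaces.card = 4 ∧ IsExtremalSub P B.edges ∧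
    ∃ H, IsNormalClarSet P B.edges H

/-- `B_3`: the extremal pentagonal fragment with 6 pentagons whose Clar extension is
normal. -/
def IsB3Frag {P : PlaneGraph V} (B : Fragment P) : Prop :=
  IsPentagonalFragment B ∧ B.inFaces.card = 6 ∧ IsExtremalSub P B.edges ∧
    ∃ H, IsNormalClarSet P B.edges H

/-- A pasting edge of the subgraph with edge set `E`: an edge of `E` lying on the
boundary of the Clar extension `C[G]` (not an edge of a Clar hexagon) whose two
end-vertices belong to `V(H)` for a Clar set `H`. -/
def IsPastingEdge (P : PlaneGraph V) (E : Finset (Sym2 V)) (e : Sym2 V) : Prop :=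
  e ∈ E ∧ ∃ H, IsClarSet P E H ∧ (∀ v : V, v ∈ e → v ∈ facesVerts H) ∧ e ∉ H.sup id

/-- `B` arises from pasting `A` and `C` along a common pasting edge:
`B = A ∪ C` and `A ∩ C` is a single pasting edge of both. -/
def IsPasting {P : PlaneGraph V} (B A C : Fragment P) : Prop :=
  B.inFaces = A.inFaces ∪ C.inFaces ∧
  ∃ e : Sym2 V, A.edges ∩ C.edges = {e} ∧ IsPastingEdge P A.edges e ∧ IsPastingEdge P C.edges e

def IsBasicFrag {P : PlaneGraph V} (B : Fragment P) : Prop :=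
  IsPentagonFrag B ∨ IsB2Frag B ∨ IsB3Frag B

/-- The pentagonal fragments generated from `P`, `B_2`, `B_3` by the pasting operation. -/
inductive Pasted (P : PlaneGraph V) : Fragment P → Prop
  | base (B : Fragment P) : IsBasicFrag B → Pasted P B
  | paste (B A C : Fragment P) : Pasted P A → IsBasicFrag C → IsPasting B A C → Pasted P B

/-- `P ∗ P`. -/
def IsPPFrag {P : PlaneGraph V} (B : Fragment P) : Prop :=
  ∃ A C : Fragment P, IsPentagonFrag A ∧ IsPentagonFrag C ∧ IsPasting B A C

/-- `P ∗ B_2`. -/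
def IsPB2Frag {P : PlaneGraph V} (B : Fragment P) : Prop :=
  ∃ A C : Fragment P, IsPentagonFrag A ∧ IsB2Frag C ∧ IsPasting B A C

/-- `P ∗ B_2 ∗ P`. -/
def IsPB2PFrag {P : PlaneGraph V} (B : Fragment P) : Prop :=
  ∃ B' A C D : Fragment P, IsPentagonFrag A ∧ IsB2Frag C ∧ IsPentagonFrag D ∧
    IsPasting B' A C ∧ IsPasting B B' D

/-- The six members of `𝓑_{≥60}`. -/
def SixShapes {P : PlaneGraph V} (B : Fragment P) : Prop :=
  IsPentagonFrag B ∨ IsB2Frag B ∨ IsB3Frag B ∨ IsPPFrag B ∨ IsPB2Frag B ∨ IsPB2PFrag B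

/-- `B_1`: two vertex-disjoint pentagons joined by an edge. -/
def IsB1 (P : PlaneGraph V) (E : Finset (Sym2 V)) : Prop :=
  ∃ (f g : Finset (Sym2 V)) (a b : V), f ∈ P.faces ∧ g ∈ P.faces ∧ f.card = 5 ∧ g.card = 5 ∧
    Disjoint (edgeVerts f) (edgeVerts g) ∧ P.graph.Adj a b ∧
    a ∈ edgeVerts f ∧ b ∈ edgeVerts g ∧ E = f ∪ g ∪ {s(a, b)}

/-- `B_1^k`: `k` copies of `B_1` pasted together along pasting edges of their pentagons. -/
inductive B1Pow (P : PlaneGraph V) : ℕ → Finset (Sym2 V) → Prop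
  | one (E : Finset (Sym2 V)) : IsB1 P E → B1Pow P 1 E
  | succ (k : ℕ) (E X : Finset (Sym2 V)) (e : Sym2 V) (f g : Finset (Sym2 V)) :
      B1Pow P k E → IsB1 P X → E ∩ X = {e} → f ∈ P.faces → g ∈ P.faces →
      f.card = 5 → g.card = 5 → f ⊆ E → g ⊆ X → e ∈ f → e ∈ g →
      IsPastingEdge P f e → IsPastingEdge P g e → B1Pow P (k + 1) (E ∪ X)

/-- `F` contains `B_1^k` for some `2 ≤ k ≤ 4` as a subgraph. -/
def ContainsB1Pow (P : PlaneGraph V) : Prop :=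
  ∃ (k : ℕ) (E : Finset (Sym2 V)), 2 ≤ k ∧ k ≤ 4 ∧ B1Pow P k E

/-- A perfect matching of the plane graph `P`. -/
def IsPerfectMatching (P : PlaneGraph V) (M : Finset (Sym2 V)) : Prop :=
  (∀ e ∈ M, e ∈ P.graph.edgeSet) ∧ IsMatching M ∧ ∀ v : V, ∃ e ∈ M, v ∈ e

/-- A sextet pattern of `P`: mutually disjoint hexagonal faces, all alternating with
respect to a common perfect matching. -/
def IsSextetPattern (P : PlaneGraph V) (H : Finset (Finset (Sym2 V))) : Prop :=
  (∀ f ∈ H, f ∈ P.faces ∧ f.card = 6) ∧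
  (∀ f ∈ H, ∀ g ∈ H, f ≠ g → Disjoint (edgeVerts f) (edgeVerts g)) ∧
  ∃ M : Finset (Sym2 V), IsPerfectMatching P M ∧ ∀ f ∈ H, (f ∩ M).card = 3

/-- A Clar formula: a maximum sextet pattern. -/
def IsClarFormula (P : PlaneGraph V) (H : Finset (Finset (Sym2 V))) : Prop :=
  IsSextetPattern P H ∧ ∀ H', IsSextetPattern P H' → H'.card ≤ H.card

/-- An extremal fullerene graph: the Clar number equals `(n − 12)/6`. -/
def IsExtremalFullerene (P : PlaneGraph V) : Prop :=
  ∃ H, IsClarFormula P H ∧ 6 * H.card = Fintype.card V - 12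

/-- The edges of the union of all maximal pentagonal fragments of `P`. -/
noncomputable def maxPentEdges (P : PlaneGraph V) : Finset (Sym2 V) :=
  @Finset.filter _
    (fun e => ∃ B : Fragment P, IsPentagonalFragment B ∧ IsMaximalIn P B.edges ∧ e ∈ B.edges)
    (Classical.decPred _) (P.faces.sup id)

/-- The disjoint union of two copies of `K_2`. -/
def twoK2 : SimpleGraph (Fin 4) := SimpleGraph.fromEdgeSet {s(0, 1), s(2, 3)}

/-- The tree `T_0` on six vertices: two adjacent 3-degree vertices, each also adjacent
to two leaves. -/
def treeT0 : SimpleGraph (Fin 6) :=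
  SimpleGraph.fromEdgeSet {s(0, 1), s(0, 2), s(0, 3), s(1, 4), s(1, 5)}



lemma mem_edgeVerts {E : Finset (Sym2 V)} {v : V} : v ∈ edgeVerts E ↔ ∃ e ∈ E, v ∈ e := by
  simp [edgeVerts]

lemma face_deg (P : PlaneGraph V) {f : Finset (Sym2 V)} (hf : f ∈ P.faces) {v : V}
    (hv : v ∈ edgeVerts f) : (f.filter fun e => v ∈ e).card = 2 := by
  obtain ⟨u, c, hc, rfl⟩ := P.face_cycle f hf
  have hvs : v ∈ c.support := by
    obtain ⟨e, he, hve⟩ := mem_edgeVerts.1 hv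
    exact SimpleGraph.Walk.mem_support_of_mem_edges (by simpa using he) hve
  have h2 := hc.ncard_neighborSet_toSubgraph_eq_two hvs
  rw [← h2, ← Set.ncard_coe_finset]
  symm
  refine Set.ncard_congr (fun w _ => s(v, w)) ?_ ?_ ?_
  · intro w hw
    simp only [SimpleGraph.Subgraph.mem_neighborSet, ← SimpleGraph.Subgraph.mem_edgeSet,
      SimpleGraph.Walk.mem_edges_toSubgraph] at hw
    simpa using hw
  · intro a b _ _ h
    exact Sym2.congr_right.1 h
  · intro e he
    simp only [Finset.coe_filter, List.mem_toFinset, Set.mem_ofPred_eq] at he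
    obtain ⟨w, rfl⟩ := he.2
    refine ⟨w, ?_, rfl⟩
    simp only [SimpleGraph.Subgraph.mem_neighborSet, ← SimpleGraph.Subgraph.mem_edgeSet,
      SimpleGraph.Walk.mem_edges_toSubgraph]
    exact he.1

lemma edge_card_verts (P : PlaneGraph V) {e : Sym2 V} (he : e ∈ P.graph.edgeSet) :
    (Finset.univ.filter fun v => v ∈ e).card = 2 := by
  induction e with
  | _ x y =>
    have : x ≠ y := P.graph.ne_of_adj he
    rw [show (Finset.univ.filter fun v => v ∈ s(x, y)) = {x, y} by ext; simp]
    exact Finset.card_pair this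

lemma face_card_verts (P : PlaneGraph V) {f : Finset (Sym2 V)} (hf : f ∈ P.faces) :
    (edgeVerts f).card = f.card := by
  have h := Finset.sum_card_bipartiteAbove_eq_sum_card_bipartiteBelow (s := edgeVerts f) (t := f)
    (fun v e => v ∈ e)
  have h1 : ∀ v ∈ edgeVerts f, (Finset.bipartiteAbove (fun v e => v ∈ e) f v).card = 2 :=
    fun v hv => face_deg P hf hv
  have h2 : ∀ e ∈ f, (Finset.bipartiteBelow (fun v e => v ∈ e) (edgeVerts f) e).card = 2 := by
    intro e he
    rw [← edge_card_verts P (P.face_edges f hf e he)]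
    congr 1
    ext v
    simp only [Finset.bipartiteBelow, Finset.mem_filter, mem_edgeVerts, Finset.mem_univ, true_and]
    exact ⟨fun h => h.2, fun h => ⟨⟨e, he, h⟩, h⟩⟩
  rw [Finset.sum_congr rfl h1, Finset.sum_congr rfl h2] at h
  simp at h
  omega

lemma walk_inv' {W : Type*} {G : SimpleGraph W} (X : W → Prop) {u w : W} (p : G.Walk u w)
    (h : ∀ a b, s(a, b) ∈ p.edges → (X a ↔ X b)) : X u ↔ X w := by
  induction p with
  | nil => rfl
  | cons hadj p ih =>
    refine (h _ _ (by rw [SimpleGraph.Walk.edges_cons]; exact List.mem_cons_self)).trans ?_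
    exact ih fun a b hab => h a b (by simp [hab])

lemma face_conn (P : PlaneGraph V) {f : Finset (Sym2 V)} (hf : f ∈ P.faces) (X : V → Prop)
    (h : ∀ a b, s(a, b) ∈ f → (X a ↔ X b)) {u w : V} (hu : u ∈ edgeVerts f)
    (hw : w ∈ edgeVerts f) (hX : X u) : X w := by
  obtain ⟨x, c, hc, rfl⟩ := P.face_cycle f hf
  have key : ∀ v, v ∈ edgeVerts c.edges.toFinset → (X x ↔ X v) := by
    intro v hv
    have hvs : v ∈ c.support := by
      obtain ⟨e, he, hve⟩ := mem_edgeVerts.1 hv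
      exact SimpleGraph.Walk.mem_support_of_mem_edges (by simpa using he) hve
    apply walk_inv' X (c.takeUntil v hvs)
    intro a b hab
    exact h a b (by simpa using c.edges_takeUntil_subset_edges hvs hab)
  exact (key w hw).1 ((key u hu).2 hX)

open Classical in
/-- edges at a vertex -/
noncomputable def star (P : PlaneGraph V) (v : V) : Finset (Sym2 V) :=
  Finset.univ.filter fun e => e ∈ P.graph.edgeSet ∧ v ∈ e

lemma mem_star {P : PlaneGraph V} {v : V} {e : Sym2 V} :
    e ∈ star P v ↔ e ∈ P.graph.edgeSet ∧ v ∈ e := by simp [star]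

lemma star_card {P : PlaneGraph V} (hP : IsFullerene P) (v : V) : (star P v).card = 3 := by
  rw [← hP.cubic v, ← Set.ncard_coe_finset]
  symm
  refine Set.ncard_congr (fun w _ => s(v, w)) ?_ ?_ ?_
  · intro w hw
    simpa [mem_star] using hw
  · intro a b _ _ h
    exact Sym2.congr_right.1 h
  · intro e he
    simp only [Finset.mem_coe, mem_star] at he
    obtain ⟨w, rfl⟩ := he.2
    exact ⟨w, he.1, rfl⟩

lemma face_filter_sub {P : PlaneGraph V} {f : Finset (Sym2 V)} (hf : f ∈ P.faces) (v : V) :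
    (f.filter fun e => v ∈ e) ⊆ star P v := by
  intro e he
  rw [Finset.mem_filter] at he
  exact mem_star.2 ⟨P.face_edges f hf e he.1, he.2⟩

/-- Faces sharing a vertex share an edge at that vertex. -/
lemma faces_share {P : PlaneGraph V} (hP : IsFullerene P) {f g : Finset (Sym2 V)}
    (hf : f ∈ P.faces) (hg : g ∈ P.faces) {v : V} (hvf : v ∈ edgeVerts f)
    (hvg : v ∈ edgeVerts g) : ∃ e, e ∈ f ∧ e ∈ g ∧ v ∈ e := by
  have h1 := face_deg P hf hvf
  have h2 := face_deg P hg hvg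
  have h3 := Finset.card_union_add_card_inter (f.filter fun e => v ∈ e) (g.filter fun e => v ∈ e)
  have h4 := Finset.card_le_card (Finset.union_subset (face_filter_sub hf v) (face_filter_sub hg v))
  rw [star_card hP] at h4
  have : 0 < ((f.filter fun e => v ∈ e) ∩ (g.filter fun e => v ∈ e)).card := by omega
  obtain ⟨e, he⟩ := Finset.card_pos.1 this
  simp only [Finset.mem_inter, Finset.mem_filter] at he
  exact ⟨e, he.1.1, he.2.1, he.1.2⟩

/-- An edge lies in exactly two faces. -/
lemma edge_two {P : PlaneGraph V} {e : Sym2 V} (he : e ∈ P.graph.edgeSet) :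
    ∃ f g, f ∈ P.faces ∧ g ∈ P.faces ∧ f ≠ g ∧ e ∈ f ∧ e ∈ g ∧
      ∀ h ∈ P.faces, e ∈ h → h = f ∨ h = g := by
  obtain ⟨f, g, hfg, h⟩ := Finset.card_eq_two.1 (P.edge_faces e he)
  have hm : ∀ x, x ∈ P.faces ∧ e ∈ x ↔ x = f ∨ x = g := by
    intro x
    have := Finset.ext_iff.1 h x
    simpa using this
  exact ⟨f, g, ((hm f).2 (.inl rfl)).1, ((hm g).2 (.inr rfl)).1, hfg,
    ((hm f).2 (.inl rfl)).2, ((hm g).2 (.inr rfl)).2, fun h hh he => (hm h).1 ⟨hh, he⟩⟩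

lemma edge_third {P : PlaneGraph V} {e : Sym2 V} {f g h : Finset (Sym2 V)} (hf : f ∈ P.faces)
    (hg : g ∈ P.faces) (hh : h ∈ P.faces) (hef : e ∈ f) (heg : e ∈ g) (heh : e ∈ h)
    (hfg : f ≠ g) : h = f ∨ h = g := by
  obtain ⟨x, y, -, -, -, -, -, hxy⟩ := edge_two (P.face_edges f hf e hef)
  have := hxy f hf hef
  have := hxy g hg heg
  have := hxy h hh heh
  grind

lemma face_two_edges {P : PlaneGraph V} {f : Finset (Sym2 V)} (hf : f ∈ P.faces) {v : V}
    (hv : v ∈ edgeVerts f) : ∃ a b, a ≠ b ∧ a ∈ f ∧ b ∈ f ∧ v ∈ a ∧ v ∈ b ∧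
      ∀ e ∈ f, v ∈ e → e = a ∨ e = b := by
  obtain ⟨a, b, hab, h⟩ := Finset.card_eq_two.1 (face_deg P hf hv)
  have hm : ∀ x, x ∈ f ∧ v ∈ x ↔ x = a ∨ x = b := by
    intro x
    have := Finset.ext_iff.1 h x
    simpa using this
  have ha := (hm a).2 (.inl rfl)
  have hb := (hm b).2 (.inr rfl)
  exact ⟨a, b, hab, ha.1, hb.1, ha.2, hb.2, fun e he hv => (hm e).1 ⟨he, hv⟩⟩

/-- no three distinct edges of a face at a vertex -/
lemma face_no_three {P : PlaneGraph V} {f : Finset (Sym2 V)} (hf : f ∈ P.faces) {v : V}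
    {a b c : Sym2 V} (ha : a ∈ f) (hb : b ∈ f) (hc : c ∈ f) (va : v ∈ a) (vb : v ∈ b)
    (vc : v ∈ c) (hab : a ≠ b) (hac : a ≠ c) (hbc : b ≠ c) : False := by
  obtain ⟨x, y, -, -, -, -, -, hxy⟩ := face_two_edges hf (mem_edgeVerts.2 ⟨a, ha, va⟩)
  have := hxy a ha va
  have := hxy b hb vb
  have := hxy c hc vc
  grind

lemma star_three {P : PlaneGraph V} (hP : IsFullerene P) {v : V} {a b : Sym2 V}
    (ha : a ∈ star P v) (hb : b ∈ star P v) (hab : a ≠ b) :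
    ∃ c, c ∈ star P v ∧ c ≠ a ∧ c ≠ b ∧ ∀ e ∈ star P v, e = a ∨ e = b ∨ e = c := by
  have h : (((star P v).erase a).erase b).card = 1 := by
    rw [Finset.card_erase_of_mem (by simp [hab.symm, hb]), Finset.card_erase_of_mem ha,
      star_card hP]
  obtain ⟨c, hc⟩ := Finset.card_eq_one.1 h
  have hm : ∀ e, (e ≠ b ∧ e ≠ a ∧ e ∈ star P v) ↔ e = c := by
    intro e
    have := Finset.ext_iff.1 hc e
    simpa using this
  have h1 := (hm c).2 rfl
  refine ⟨c, h1.2.2, h1.2.1, h1.1, fun e he => ?_⟩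
  by_cases hea : e = a
  · exact .inl hea
  by_cases heb : e = b
  · exact .inr (.inl heb)
  exact .inr (.inr ((hm e).1 ⟨heb, hea, he⟩))

lemma star_all {P : PlaneGraph V} (hP : IsFullerene P) {v : V} {a b c : Sym2 V}
    (ha : a ∈ star P v) (hb : b ∈ star P v) (hc : c ∈ star P v) (hab : a ≠ b) (hac : a ≠ c)
    (hbc : b ≠ c) : star P v = {a, b, c} := by
  symm
  apply Finset.eq_of_subset_of_card_le
  · intro e he
    simp at he
    rcases he with rfl | rfl | rfl <;> assumption
  · rw [star_card hP, Finset.card_eq_three.2 ⟨a, b, c, hab, hac, hbc, rfl⟩]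

/-- Two distinct faces do not share two edges at a vertex. -/
lemma share_adj {P : PlaneGraph V} (hP : IsFullerene P) {f g : Finset (Sym2 V)}
    (hf : f ∈ P.faces) (hg : g ∈ P.faces) (hfg : f ≠ g) {v : V} {a b : Sym2 V} (hab : a ≠ b)
    (va : v ∈ a) (vb : v ∈ b) (haf : a ∈ f) (hbf : b ∈ f) (hag : a ∈ g) (hbg : b ∈ g) :
    False := by
  obtain ⟨c, hc, hca, hcb, hall⟩ := star_three hP
    (mem_star.2 ⟨P.face_edges f hf a haf, va⟩) (mem_star.2 ⟨P.face_edges f hf b hbf, vb⟩) hab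
  obtain ⟨hce, vc⟩ := mem_star.1 hc
  obtain ⟨x, y, hx, -, -, hcx, -, -⟩ := edge_two hce
  obtain ⟨p, q, hpq, hp, hq, vp, vq, -⟩ := face_two_edges hx (mem_edgeVerts.2 ⟨c, hcx, vc⟩)
  have hxf : x ≠ f := by
    rintro rfl
    exact face_no_three hf haf hbf hcx va vb vc hab hca.symm hcb.symm
  have hxg : x ≠ g := by
    rintro rfl
    exact face_no_three hg hag hbg hcx va vb vc hab hca.symm hcb.symm
  have h1 := hall p (mem_star.2 ⟨P.face_edges x hx p hp, vp⟩)
  have h2 := hall q (mem_star.2 ⟨P.face_edges x hx q hq, vq⟩)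
  have h3 : a ∉ x := fun h => by
    rcases edge_third hf hg hx haf hag h hfg with h | h <;> contradiction
  have h4 : b ∉ x := fun h => by
    rcases edge_third hf hg hx hbf hbg h hfg with h | h <;> contradiction
  grind

/-- Any two edges at a vertex lie in a common face. -/
lemma corner_face {P : PlaneGraph V} (hP : IsFullerene P) {v : V} {a b : Sym2 V}
    (ha : a ∈ star P v) (hb : b ∈ star P v) (hab : a ≠ b) :
    ∃ f ∈ P.faces, a ∈ f ∧ b ∈ f := by
  obtain ⟨c, hc, hca, hcb, hall⟩ := star_three hP ha hb hab
  rw [mem_star] at ha hb hc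
  obtain ⟨f, g, hf, hg, hfg, haf, hag, -⟩ := edge_two ha.1
  have key : ∀ x ∈ P.faces, a ∈ x → b ∈ x ∨ c ∈ x := by
    intro x hx hax
    obtain ⟨p, q, hpq, hp, hq, vp, vq, -⟩ := face_two_edges hx (mem_edgeVerts.2 ⟨a, hax, ha.2⟩)
    have h1 := hall p (mem_star.2 ⟨P.face_edges x hx p hp, vp⟩)
    have h2 := hall q (mem_star.2 ⟨P.face_edges x hx q hq, vq⟩)
    grind
  rcases key f hf haf with h | h
  · exact ⟨f, hf, haf, h⟩
  rcases key g hg hag with h' | h'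
  · exact ⟨g, hg, hag, h'⟩
  exact (share_adj hP hf hg hfg hca.symm ha.2 hc.2 haf h hag h').elim

lemma graph_connected {P : PlaneGraph V} (hP : IsFullerene P) : P.graph.Connected := by
  have h := hP.threeConnected ∅ (by simp)
  rw [Set.compl_empty] at h
  exact (SimpleGraph.induceUnivIso P.graph).connected_iff.1 h

lemma conn_inv {P : PlaneGraph V} (hP : IsFullerene P) (X : V → Prop)
    (h : ∀ a b, P.graph.Adj a b → (X a ↔ X b)) (u w : V) : X u ↔ X w := by
  obtain ⟨p⟩ := (graph_connected hP).preconnected u w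
  exact walk_inv' X p fun a b hab => h a b (p.adj_of_mem_edges hab)

open Classical in
lemma euler' {P : PlaneGraph V} :
    Fintype.card V + P.faces.card = Fintype.card {e // e ∈ P.graph.edgeSet} + 2 := by
  have h := Finset.sum_card_bipartiteAbove_eq_sum_card_bipartiteBelow (s := P.faces)
    (t := P.graph.edgeFinset) (fun f e => e ∈ f)
  have h1 : ∀ f ∈ P.faces, (Finset.bipartiteAbove (fun f e => e ∈ f) P.graph.edgeFinset f).card
      = f.card := by
    intro f hf
    congr 1
    ext e
    simp only [Finset.bipartiteAbove, Finset.mem_filter, SimpleGraph.mem_edgeFinset]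
    exact ⟨fun h => h.2, fun h => ⟨P.face_edges f hf e h, h⟩⟩
  have h2 : ∀ e ∈ P.graph.edgeFinset,
      (Finset.bipartiteBelow (fun f e => e ∈ f) P.faces e).card = 2 := by
    intro e he
    exact P.edge_faces e (by simpa using he)
  rw [Finset.sum_congr rfl h1, Finset.sum_congr rfl h2] at h
  have h3 : Fintype.card {e // e ∈ P.graph.edgeSet} = P.graph.edgeFinset.card := by
    rw [Fintype.card_subtype]; congr 1; ext; simp
  have := P.euler
  rw [Finset.sum_const, smul_eq_mul] at h
  rw [h, ← h3] at this
  omega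



open Classical in
/-- vertex-edge incidence over `ZMod 2` -/
noncomputable def D1 (P : PlaneGraph V) : Matrix {e // e ∈ P.graph.edgeSet} V (ZMod 2) :=
  Matrix.of fun e v => if v ∈ e.1 then 1 else 0

open Classical in
/-- edge-face incidence over `ZMod 2` -/
noncomputable def D2 (P : PlaneGraph V) :
    Matrix {f // f ∈ P.faces} {e // e ∈ P.graph.edgeSet} (ZMod 2) :=
  Matrix.of fun f e => if e.1 ∈ f.1 then 1 else 0

lemma D1_mulVec (P : PlaneGraph V) (χ : V → ZMod 2) (a b : V) (h : s(a, b) ∈ P.graph.edgeSet) :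
    (D1 P).mulVec χ ⟨s(a, b), h⟩ = χ a + χ b := by
  have hab : a ≠ b := P.graph.ne_of_adj h
  simp only [Matrix.mulVec, dotProduct, D1, Matrix.of_apply, ite_mul, one_mul, zero_mul]
  rw [← Finset.sum_filter, show (Finset.univ.filter fun v => v ∈ s(a, b)) = {a, b} by ext; simp,
    Finset.sum_pair hab]

open Classical in
lemma D2_mulVec (P : PlaneGraph V) (S : Finset (Sym2 V)) (f : {f // f ∈ P.faces}) :
    (D2 P).mulVec (fun e => if e.1 ∈ S then 1 else 0) f = ((f.1 ∩ S).card : ZMod 2) := by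
  simp only [Matrix.mulVec, dotProduct, D2, Matrix.of_apply, ite_mul, one_mul, zero_mul, ← ite_and]
  rw [Finset.sum_boole]
  congr 1
  apply Finset.card_bij (fun e _ => e.1)
  · intro e he
    simpa using he
  · intro a _ b _ h
    exact Subtype.ext h
  · intro e he
    rw [Finset.mem_inter] at he
    exact ⟨⟨e, P.face_edges _ f.2 e he.1⟩, by simpa using he, rfl⟩

lemma ker_le_one {ι : Type*} [Fintype ι] (W : Submodule (ZMod 2) (ι → ZMod 2))
    (h : ∀ x ∈ W, ∀ i j, x i = x j) : Module.finrank (ZMod 2) W ≤ 1 := by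
  have hle : W ≤ Submodule.span (ZMod 2) {fun _ => 1} := by
    intro x hx
    rw [Submodule.mem_span_singleton]
    by_cases hι : Nonempty ι
    · obtain ⟨i⟩ := hι
      refine ⟨x i, ?_⟩
      ext j
      simp [h x hx j i]
    · exact ⟨0, by ext j; exact (hι ⟨j⟩).elim⟩
  exact (Submodule.finrank_mono hle).trans ((finrank_span_le_card _).trans (by simp))

lemma zmod2_add_eq_zero (a b : ZMod 2) : a + b = 0 ↔ a = b := by
  revert a b; decide

open Classical in
lemma D2T_mulVec (P : PlaneGraph V) (y : {f // f ∈ P.faces} → ZMod 2)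
    (e : {e // e ∈ P.graph.edgeSet}) (f g : {f // f ∈ P.faces}) (hfg : f ≠ g)
    (hef : e.1 ∈ f.1) (heg : e.1 ∈ g.1) : (D2 P).transpose.mulVec y e = y f + y g := by
  simp only [Matrix.mulVec, dotProduct, D2, Matrix.transpose_apply, Matrix.of_apply, ite_mul,
    one_mul, zero_mul]
  rw [← Finset.sum_filter, show (Finset.univ.filter fun h : {f // f ∈ P.faces} => e.1 ∈ h.1)
    = {f, g} from ?_, Finset.sum_pair hfg]
  ext h
  simp only [Finset.mem_filter, Finset.mem_univ, true_and, Finset.mem_insert,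
    Finset.mem_singleton]
  constructor
  · intro heh
    rcases edge_third f.2 g.2 h.2 hef heg heh (fun h => hfg (Subtype.ext h)) with h | h
    · exact .inl (Subtype.ext h)
    · exact .inr (Subtype.ext h)
  · rintro (rfl | rfl) <;> assumption

lemma vert_in_face {P : PlaneGraph V} (hP : IsFullerene P) (v : V) :
    ∃ f ∈ P.faces, v ∈ edgeVerts f := by
  have : 0 < (star P v).card := by rw [star_card hP]; norm_num
  obtain ⟨e, he⟩ := Finset.card_pos.1 this
  rw [mem_star] at he
  obtain ⟨f, g, hf, -, -, hef, -⟩ := edge_two he.1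
  exact ⟨f, hf, mem_edgeVerts.2 ⟨e, hef, he.2⟩⟩

lemma face_nonempty {P : PlaneGraph V} (hP : IsFullerene P) {f} (hf : f ∈ P.faces) :
    ∃ v, v ∈ edgeVerts f := by
  have h1 := hP.faceSize f hf
  have h2 := face_card_verts P hf
  have : 0 < (edgeVerts f).card := by omega
  exact Finset.card_pos.1 this

lemma dual_const {P : PlaneGraph V} (hP : IsFullerene P) (y : {f // f ∈ P.faces} → ZMod 2)
    (hy : (D2 P).transpose.mulVec y = 0) (f g : {f // f ∈ P.faces}) : y f = y g := by
  have h1 : ∀ f g : {f // f ∈ P.faces}, ∀ e, e ∈ f.1 → e ∈ g.1 → y f = y g := by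
    intro f g e hef heg
    by_cases hfg : f = g
    · rw [hfg]
    have := D2T_mulVec P y ⟨e, P.face_edges _ f.2 e hef⟩ f g hfg hef heg
    rw [hy] at this
    exact (zmod2_add_eq_zero _ _).1 this.symm
  have h2 : ∀ f g : {f // f ∈ P.faces}, ∀ v, v ∈ edgeVerts f.1 → v ∈ edgeVerts g.1 →
      y f = y g := by
    intro f g v hvf hvg
    obtain ⟨e, he, he', -⟩ := faces_share hP f.2 g.2 hvf hvg
    exact h1 f g e he he'
  obtain ⟨u, hu⟩ := face_nonempty hP f.2
  obtain ⟨w, hw⟩ := face_nonempty hP g.2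
  have key := conn_inv hP (fun v => ∀ h : {f // f ∈ P.faces}, v ∈ edgeVerts h.1 → y f = y h)
    (fun a b hab => by
      obtain ⟨x, _, hx, -, -, hex, -⟩ := edge_two (P := P) (e := s(a, b)) hab
      have hax : a ∈ edgeVerts x := mem_edgeVerts.2 ⟨_, hex, by simp⟩
      have hbx : b ∈ edgeVerts x := mem_edgeVerts.2 ⟨_, hex, by simp⟩
      constructor
      · intro h k hk
        rw [h ⟨x, hx⟩ hax]
        exact h2 ⟨x, hx⟩ k b hbx hk
      · intro h k hk
        rw [h ⟨x, hx⟩ hbx]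
        exact h2 ⟨x, hx⟩ k a hax hk) u w
  exact key.1 (fun h hh => h2 f h u hu hh) g hw

open Classical in
lemma cut_lemma {P : PlaneGraph V} (hP : IsFullerene P) (S : Finset (Sym2 V))
    (hS : ∀ f ∈ P.faces, Even (f ∩ S).card) :
    ∃ χ : V → Bool, ∀ a b, P.graph.Adj a b → (s(a, b) ∈ S ↔ χ a ≠ χ b) := by
  have hmul : ∀ (x : V → ZMod 2), (D2 P).mulVec ((D1 P).mulVec x) = 0 := by
    have h0 : D2 P * D1 P = 0 := by
      ext f v
      have := D2_mulVec P (f.1.filter fun e => v ∈ e) f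
      have h2 : (((f.1 ∩ f.1.filter fun e => v ∈ e).card : ℕ) : ZMod 2) = 0 := by
        rw [Finset.inter_eq_right.2 (Finset.filter_subset _ _)]
        by_cases hv : v ∈ edgeVerts f.1
        · rw [face_deg P f.2 hv]; rfl
        · rw [Finset.card_eq_zero.2]
          · simp
          · ext e
            simp only [Finset.mem_filter, Finset.notMem_empty, iff_false]
            exact fun h => hv (mem_edgeVerts.2 ⟨e, h.1, h.2⟩)
      rw [h2] at this
      simp only [Matrix.mul_apply, Matrix.zero_apply]
      rw [← this]
      simp only [Matrix.mulVec, dotProduct]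
      apply Finset.sum_congr rfl
      intro e _
      simp only [D1, D2, Matrix.of_apply, Finset.mem_filter]
      by_cases he : e.1 ∈ f.1 <;> simp [he]
    intro x
    rw [Matrix.mulVec_mulVec, h0, Matrix.zero_mulVec]
  have hle : LinearMap.range (D1 P).mulVecLin ≤ LinearMap.ker (D2 P).mulVecLin := by
    rintro _ ⟨x, rfl⟩
    rw [LinearMap.mem_ker]
    exact hmul x
  have r1 := (D1 P).mulVecLin.finrank_range_add_finrank_ker
  have r2 := (D2 P).mulVecLin.finrank_range_add_finrank_ker
  have r3 := (D2 P).transpose.mulVecLin.finrank_range_add_finrank_ker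
  have r4 : Module.finrank (ZMod 2) (LinearMap.range (D2 P).transpose.mulVecLin) =
    Module.finrank (ZMod 2) (LinearMap.range (D2 P).mulVecLin) := Matrix.rank_transpose (D2 P)
  have k1 : Module.finrank (ZMod 2) (LinearMap.ker (D1 P).mulVecLin) ≤ 1 := by
    apply ker_le_one
    intro x hx i j
    rw [LinearMap.mem_ker] at hx
    refine ((conn_inv hP (fun v => x i = x v) ?_ i j).1 rfl)
    intro a b hab
    have := D1_mulVec P x a b hab
    rw [show (D1 P).mulVec x = 0 from hx] at this
    have := (zmod2_add_eq_zero _ _).1 this.symm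
    rw [this]
  have k2 : Module.finrank (ZMod 2) (LinearMap.ker (D2 P).transpose.mulVecLin) ≤ 1 := by
    apply ker_le_one
    intro x hx i j
    rw [LinearMap.mem_ker] at hx
    exact dual_const hP x hx i j
  have eu := euler' (P := P)
  simp only [Module.finrank_fintype_fun_eq_card, Fintype.card_coe] at r1 r2 r3
  have heq := Submodule.eq_of_le_of_finrank_le hle (by omega)
  have hmem : (fun e : {e // e ∈ P.graph.edgeSet} => if e.1 ∈ S then (1 : ZMod 2) else 0) ∈
      LinearMap.ker (D2 P).mulVecLin := by
    rw [LinearMap.mem_ker]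
    ext f
    have := D2_mulVec P S f
    refine this.trans ?_
    rw [Pi.zero_apply, ZMod.natCast_eq_zero_iff]
    exact (hS f.1 f.2).two_dvd
  rw [← heq] at hmem
  obtain ⟨x, hx⟩ := hmem
  refine ⟨fun v => decide (x v = 0), fun a b hab => ?_⟩
  have h1 := D1_mulVec P x a b hab
  have h2 := congrFun hx ⟨s(a, b), hab⟩
  rw [Matrix.mulVecLin_apply, h1] at h2
  simp only at h2
  by_cases hs : s(a, b) ∈ S
  · simp only [hs, if_true, true_iff] at h2 ⊢
    generalize x a = p at h2; generalize x b = q at h2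
    revert h2; revert p q; decide
  · simp only [hs, if_false, false_iff] at h2 ⊢
    generalize x a = p at h2; generalize x b = q at h2
    revert h2; revert p q; decide

/-- Two distinct faces share at most one edge. -/
lemma share_one {P : PlaneGraph V} (hP : IsFullerene P) {f g : Finset (Sym2 V)}
    (hf : f ∈ P.faces) (hg : g ∈ P.faces) (hfg : f ≠ g) {a b : Sym2 V}
    (haf : a ∈ f) (hbf : b ∈ f) (hag : a ∈ g) (hbg : b ∈ g) : a = b := by
  by_contra hab
  have hdis : ∀ v, v ∈ a → v ∉ b := fun v va vb =>
    share_adj hP hf hg hfg hab va vb haf hbf hag hbg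
  obtain ⟨χ, hχ⟩ := cut_lemma hP {a, b} (by
    intro h hh
    by_cases hc : h = f ∨ h = g
    · have : h ∩ {a, b} = {a, b} := by
        apply Finset.inter_eq_right.2
        rcases hc with rfl | rfl <;> simp [Finset.insert_subset_iff, *]
      rw [this, Finset.card_pair hab]
      exact even_two
    · have : h ∩ {a, b} = ∅ := by
        ext e
        simp only [Finset.mem_inter, Finset.mem_insert, Finset.mem_singleton,
          Finset.notMem_empty, iff_false]
        rintro ⟨he, rfl | rfl⟩
        · exact hc (edge_third hf hg hh haf hag he hfg)
        · exact hc (edge_third hf hg hh hbf hbg he hfg)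
      simp [this])
  have split : ∀ e, e ∈ P.graph.edgeSet → (e = a ∨ e = b) →
      ∃ x y, e = s(x, y) ∧ χ x = true ∧ χ y = false ∧ x ≠ y := by
    intro e he hab'
    induction e with
    | _ x y =>
      have h1 := (hχ x y he).1 (by simpa using hab')
      have h2 : x ≠ y := P.graph.ne_of_adj he
      cases hx : χ x <;> cases hy : χ y <;> simp [hx, hy] at h1
      · exact ⟨y, x, Sym2.eq_swap, hy, hx, h2.symm⟩
      · exact ⟨x, y, rfl, hx, hy, h2⟩
  obtain ⟨w, u, ha, hw, hu, -⟩ := split a (P.face_edges f hf a haf) (.inl rfl)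
  obtain ⟨w', u', hb, hw', hu', -⟩ := split b (P.face_edges f hf b hbf) (.inr rfl)
  have hww : w ≠ w' := by
    rintro rfl
    exact hdis w (by simp [ha]) (by simp [hb])
  have huu : u ≠ u' := by
    rintro rfl
    exact hdis u (by simp [ha]) (by simp [hb])
  have hcon := hP.threeConnected {w, u'} ((Set.ncard_insert_le _ _).trans (by simp))
  have hwu : w ≠ u := by rintro rfl; simp [hw] at hu
  have hwu' : w' ≠ u' := by rintro rfl; simp [hw'] at hu'
  obtain ⟨p⟩ := hcon.preconnected ⟨w', by simp [hww.symm, hwu']⟩ ⟨u, by simp [hwu.symm, huu]⟩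
  have := walk_inv' (fun x => χ x.1 = true) p (by
    rintro ⟨x, hx⟩ ⟨y, hy⟩ hxy
    have hadj := p.adj_of_mem_edges hxy
    simp only [SimpleGraph.comap_adj, Function.Embedding.subtype_apply] at hadj
    have hne : s(x, y) ∉ ({a, b} : Finset (Sym2 V)) := by
      simp only [Set.mem_compl_iff, Set.mem_insert_iff, Set.mem_singleton_iff, not_or] at hx hy
      rw [ha, hb]
      simp only [Finset.mem_insert, Finset.mem_singleton, Sym2.eq_iff]
      grind
    have := (hχ x y hadj).not.1 hne
    rw [not_not] at this
    simp only [this])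
  simp [hw', hu] at this



/-- The combinatorial structure of a ring of five pentagons. -/
structure RD (P : PlaneGraph V) (R : ZMod 5 → Finset (Sym2 V)) where
  χ : V → Bool
  t : Bool → ZMod 5 → V
  d : ZMod 5 → V
  face : ∀ i, R i ∈ P.faces
  card : ∀ i, (R i).card = 5
  inj : Function.Injective R
  tχ : ∀ k i, χ (t k i) = k
  sp1 : ∀ k i, s(t k i, t (!k) i) ∈ R i
  sp2 : ∀ k i, s(t k (i+1), t (!k) (i+1)) ∈ R i
  e1 : ∀ k i, χ (d i) = k → s(t k i, d i) ∈ R i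
  e2 : ∀ k i, χ (d i) = k → s(t k (i+1), d i) ∈ R i
  e3 : ∀ k i, χ (d i) ≠ k → s(t k i, t k (i+1)) ∈ R i
  tt : ∀ k i j, t k i = t k j → i = j
  td : ∀ k i j, t k i ≠ d j
  dd : ∀ i j, d i = d j → i = j
  tR : ∀ k i j, t k i ∈ edgeVerts (R j) → j = i ∨ j + 1 = i
  dR : ∀ i j, d i ∈ edgeVerts (R j) → j = i
  Rv : ∀ i v, v ∈ edgeVerts (R i) → v = d i ∨ ∃ k, v = t k i ∨ v = t k (i+1)

lemma ring_struct {P : PlaneGraph V} (hP : IsFullerene P) {R : ZMod 5 → Finset (Sym2 V)}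
    (hR : IsPentRing P 5 R) : Nonempty (RD P R) := by
  obtain ⟨hinj, hface, hmeet⟩ := hR
  have hF : ∀ i, R i ∈ P.faces := fun i => (hface i).1
  have ne1 : ∀ i : ZMod 5, i ≠ i + 1 := by decide
  have ex : ∀ i : ZMod 5, ∃ e, e ∈ R i ∧ e ∈ R (i - 1) := by
    intro i
    obtain ⟨v, hv⟩ := (hmeet (i - 1) i (by revert i; decide)).2 (.inl (by ring))
    rw [Finset.mem_inter] at hv
    obtain ⟨e, h1, h2, -⟩ := faces_share hP (hF _) (hF _) hv.2 hv.1
    exact ⟨e, h1, h2⟩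
  choose e he1 he2' using ex
  have he2 : ∀ i, e (i + 1) ∈ R i := fun i => by
    have := he2' (i + 1)
    rwa [add_sub_cancel_right] at this
  have far : ∀ i v, v ∈ edgeVerts (R i) → v ∈ edgeVerts (R (i + 2)) → False := by
    intro i v h1 h2
    have hne : ∀ i : ZMod 5, i ≠ i + 2 ∧ ¬ (i + 2 = i + 1 ∨ i = i + 2 + 1) := by decide
    exact (hne i).2 ((hmeet i (i + 2) (hne i).1).1 ⟨v, Finset.mem_inter.2 ⟨h1, h2⟩⟩)
  have mem : ∀ i v, v ∈ edgeVerts (R i) → v ∈ edgeVerts (R (i + 1)) → v ∈ e (i + 1) := by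
    intro i v h1 h2
    obtain ⟨a, h3, h4, h5⟩ := faces_share hP (hF _) (hF _) h1 h2
    rwa [← share_one hP (hF i) (hF (i + 1)) (fun h => ne1 i (hinj h)) h3 (he2 i) h4 (he1 (i + 1))]
  have ev1 : ∀ i v, v ∈ e i → v ∈ edgeVerts (R i) := fun i v hv =>
    mem_edgeVerts.2 ⟨_, he1 i, hv⟩
  have ev2 : ∀ i v, v ∈ e (i + 1) → v ∈ edgeVerts (R i) := fun i v hv =>
    mem_edgeVerts.2 ⟨_, he2 i, hv⟩
  have evR : ∀ i j v, v ∈ e i → v ∈ edgeVerts (R j) → j = i ∨ j + 1 = i := by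
    intro i j v hv hj
    obtain ⟨i, rfl⟩ : ∃ i', i = i' + 1 := ⟨i - 1, by ring⟩
    have h1 := ev1 _ v hv
    have h2 := ev2 _ v hv
    have hd : ∀ i j : ZMod 5, j = i + 1 ∨ j + 1 = i + 1 ∨ j = i + 2 ∨ j = i + 1 + 2 ∨
        i + 1 = j + 2 := by decide
    rcases hd i j with h | h | h | h | h
    · exact .inl h
    · exact .inr h
    · subst h; exact (far i v h2 hj).elim
    · subst h; exact (far _ v h1 hj).elim
    · rw [h] at h1; exact (far j v hj h1).elim
  have edis : ∀ i j v, v ∈ e i → v ∈ e j → i = j := by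
    intro i j v hi hj
    have h1 := evR i j v hi (ev1 j v hj)
    obtain ⟨j, rfl⟩ : ∃ i', j = i' + 1 := ⟨j - 1, by ring⟩
    have h2 := evR i j v hi (ev2 j v hj)
    clear hi hj
    revert h1 h2; revert i j; decide
  have eRj : ∀ i j, e i ∈ R j → j = i ∨ j + 1 = i := by
    intro i j h
    have : ∃ v, v ∈ e i := by
      induction e i with
      | _ x y => exact ⟨x, by simp⟩
    obtain ⟨v, hv⟩ := this
    exact evR i j v hv (mem_edgeVerts.2 ⟨_, h, hv⟩)
  have einj : ∀ i j, e i = e j → i = j := by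
    intro i j h
    have : ∃ v, v ∈ e i := by
      induction e i with
      | _ x y => exact ⟨x, by simp⟩
    obtain ⟨v, hv⟩ := this
    exact edis i j v hv (h ▸ hv)
  have heE : ∀ i, e i ∈ P.graph.edgeSet := fun i => P.face_edges _ (hF i) _ (he1 i)
  obtain ⟨χ, hχ⟩ := cut_lemma hP (Finset.univ.image e) (by
    intro f hf
    by_cases hc : ∃ i, f = R i
    · obtain ⟨i, rfl⟩ := hc
      have : R i ∩ Finset.univ.image e = {e i, e (i + 1)} := by
        ext a
        simp only [Finset.mem_inter, Finset.mem_image, Finset.mem_univ, true_and,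
          Finset.mem_insert, Finset.mem_singleton]
        constructor
        · rintro ⟨h, j, rfl⟩
          rcases eRj j i h with rfl | rfl
          · exact .inl rfl
          · exact .inr rfl
        · rintro (rfl | rfl)
          · exact ⟨he1 i, i, rfl⟩
          · exact ⟨he2 i, i + 1, rfl⟩
      rw [this, Finset.card_pair (fun h => ne1 i (einj _ _ h))]
      exact even_two
    · have : f ∩ Finset.univ.image e = ∅ := by
        ext a
        simp only [Finset.mem_inter, Finset.mem_image, Finset.mem_univ, true_and,
          Finset.notMem_empty, iff_false]
        rintro ⟨h, j, rfl⟩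
        obtain ⟨j, rfl⟩ : ∃ i', j = i' + 1 := ⟨j - 1, by ring⟩
        rcases edge_third (hF j) (hF (j + 1)) hf (he2 j) (he1 _) h
          (fun h => ne1 j (hinj h)) with h | h
        · exact hc ⟨_, h⟩
        · exact hc ⟨_, h⟩
      simp [this])
  have ext_ : ∀ k i, ∃ x, x ∈ e i ∧ χ x = k := by
    intro k i
    have h1 := heE i
    have h2 : e i ∈ Finset.univ.image e := Finset.mem_image_of_mem _ (Finset.mem_univ i)
    generalize e i = a at h1 h2 ⊢
    induction a with
    | _ x y =>
      have := (hχ x y h1).1 h2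
      by_cases hx : χ x = k
      · exact ⟨x, by simp, hx⟩
      · refine ⟨y, by simp, ?_⟩
        revert this hx
        generalize χ x = p; generalize χ y = q
        revert p q k; decide
  choose t ht htχ using ext_
  have tne : ∀ k i j, t k i ≠ t (!k) j := by
    intro k i j h
    have h1 := htχ k i
    rw [h, htχ] at h1
    clear h
    revert h1; revert k; decide
  have hes : ∀ k i, e i = s(t k i, t (!k) i) := fun k i =>
    (Sym2.mem_and_mem_iff (tne k i i)).1 ⟨ht k i, ht _ i⟩
  have htt : ∀ k i j, t k i = t k j → i = j := fun k i j h =>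
    edis i j (t k i) (ht k i) (h ▸ ht k j)
  -- the fifth vertex
  have exd : ∀ i, ∃ x, x ∈ edgeVerts (R i) ∧ (∀ k, x ≠ t k i ∧ x ≠ t k (i + 1)) ∧
      ∀ v ∈ edgeVerts (R i), v = x ∨ ∃ k, v = t k i ∨ v = t k (i+1) := by
    intro i
    set Q : Finset V := {t false i, t true i, t false (i+1), t true (i+1)} with hQ
    have hQc : Q.card = 4 := by
      have a1 : t false i ≠ t true i := tne false i i
      have a2 : t false i ≠ t true (i+1) := tne false i (i+1)
      have a3 : t true i ≠ t false (i+1) := tne true i (i+1)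
      have a4 : t false (i+1) ≠ t true (i+1) := tne false _ _
      have a5 : t false i ≠ t false (i+1) := fun h => ne1 i (htt _ _ _ h)
      have a6 : t true i ≠ t true (i+1) := fun h => ne1 i (htt _ _ _ h)
      rw [hQ, Finset.card_insert_of_notMem (by simp [a1, a2, a5]),
        Finset.card_insert_of_notMem (by simp [a3, a6]), Finset.card_pair a4]
    have hQs : Q ⊆ edgeVerts (R i) := by
      intro x hx
      simp only [hQ, Finset.mem_insert, Finset.mem_singleton] at hx
      rcases hx with rfl | rfl | rfl | rfl
      · exact ev1 _ _ (ht _ _)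
      · exact ev1 _ _ (ht _ _)
      · exact ev2 _ _ (ht _ _)
      · exact ev2 _ _ (ht _ _)
    have hc : (edgeVerts (R i) \ Q).card = 1 := by
      rw [Finset.card_sdiff_of_subset hQs, hQc, face_card_verts P (hF i), (hface i).2]
    obtain ⟨x, hx⟩ := Finset.card_eq_one.1 hc
    have hm : ∀ v, (v ∈ edgeVerts (R i) ∧ v ∉ Q) ↔ v = x := by
      intro v
      have := Finset.ext_iff.1 hx v
      simpa only [Finset.mem_sdiff, Finset.mem_singleton] using this
    have hxx := (hm x).2 rfl
    refine ⟨x, hxx.1, ?_, ?_⟩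
    · intro k
      have := hxx.2
      simp only [hQ, Finset.mem_insert, Finset.mem_singleton, not_or] at this
      cases k
      · exact ⟨this.1, this.2.2.1⟩
      · exact ⟨this.2.1, this.2.2.2⟩
    · intro v hv
      by_cases hvQ : v ∈ Q
      · right
        simp only [hQ, Finset.mem_insert, Finset.mem_singleton] at hvQ
        rcases hvQ with h | h | h | h
        · exact ⟨_, .inl h⟩
        · exact ⟨_, .inl h⟩
        · exact ⟨_, .inr h⟩
        · exact ⟨_, .inr h⟩
      · exact .inl ((hm v).1 ⟨hv, hvQ⟩)
  choose d hd1 hd2 hd3 using exd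
  have hde : ∀ i j, d i ∉ e j := by
    intro i j h
    have h1 := evR j i _ h (hd1 i)
    rw [hes true j, Sym2.mem_iff] at h
    rcases h1 with rfl | rfl
    · rcases h with h | h
      · exact (hd2 i _).1 h
      · exact (hd2 i _).1 h
    · rcases h with h | h
      · exact (hd2 i _).2 h
      · exact (hd2 i _).2 h
  have hdR : ∀ i j, d i ∈ edgeVerts (R j) → j = i := by
    intro i j h
    by_contra hne
    rcases (hmeet i j (Ne.symm hne)).1 ⟨_, Finset.mem_inter.2 ⟨hd1 i, h⟩⟩ with rfl | rfl
    · exact hde _ _ (mem i _ (hd1 i) h)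
    · exact hde _ _ (mem j _ h (hd1 _))
  -- other end of a non-spoke edge
  have mono : ∀ i x y, s(x, y) ∈ R i → (∀ j, s(x, y) ≠ e j) →
      y ∈ edgeVerts (R i) ∧ χ x = χ y ∧ x ≠ y := by
    intro i x y h hne
    have hadj : P.graph.Adj x y := P.face_edges _ (hF i) _ h
    refine ⟨mem_edgeVerts.2 ⟨_, h, by simp⟩, ?_, hadj.ne⟩
    have := (hχ x y hadj).not.1 (by
      simp only [Finset.mem_image, Finset.mem_univ, true_and, not_exists]
      exact fun j hj => hne j hj.symm)
    simpa using this
  have dedge : ∀ i a, a ∈ R i → d i ∈ a → a = s(t (χ (d i)) i, d i) ∨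
      a = s(t (χ (d i)) (i+1), d i) := by
    intro i a ha hda
    obtain ⟨y, rfl⟩ := hda
    obtain ⟨hy, hc, hne⟩ := mono i _ _ ha (fun j h => hde i j (h ▸ by simp))
    rcases hd3 i y hy with rfl | ⟨k, rfl | rfl⟩
    · exact (hne rfl).elim
    · rw [hc, htχ]; exact .inl Sym2.eq_swap
    · rw [hc, htχ]; exact .inr Sym2.eq_swap
  have dboth : ∀ i, s(t (χ (d i)) i, d i) ∈ R i ∧ s(t (χ (d i)) (i+1), d i) ∈ R i := by
    intro i
    obtain ⟨a, b, hab, ha, hb, da, db, -⟩ := face_two_edges (hF i) (hd1 i)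
    rcases dedge i a ha da with h | h <;> rcases dedge i b hb db with h' | h'
    · exact (hab (h.trans h'.symm)).elim
    · exact ⟨h ▸ ha, h' ▸ hb⟩
    · exact ⟨h' ▸ hb, h ▸ ha⟩
    · exact (hab (h.trans h'.symm)).elim
  refine ⟨⟨χ, t, d, hF, fun i => (hface i).2, hinj, htχ, ?_, ?_, ?_, ?_, ?_, htt, ?_, ?_, ?_,
    hdR, hd3⟩⟩
  · intro k i; rw [← hes]; exact he1 i
  · intro k i; rw [← hes]; exact he2 i
  · rintro k i rfl; exact (dboth i).1
  · rintro k i rfl; exact (dboth i).2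
  · intro k i hk
    obtain ⟨a, b, hab, ha, hb, ta, tb, -⟩ := face_two_edges (hF i) (ev1 i _ (ht k i))
    have key : ∀ c, c ∈ R i → t k i ∈ c → c ≠ e i → s(t k i, t k (i+1)) ∈ R i := by
      intro c hc htc hce
      obtain ⟨y, rfl⟩ := htc
      obtain ⟨hy, hcol, hne⟩ := mono i _ _ hc (fun j h => by
        have : i = j := edis i j (t k i) (ht k i) (h ▸ by simp)
        subst this
        exact hce h)
      rw [htχ] at hcol
      rcases hd3 i y hy with rfl | ⟨k', rfl | rfl⟩
      · exact (hk hcol.symm).elim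
      · rw [htχ] at hcol; subst hcol; exact (hne rfl).elim
      · rw [htχ] at hcol; subst hcol; exact hc
    by_cases h : a = e i
    · exact key b hb tb (fun h' => hab (h.trans h'.symm))
    · exact key a ha ta h
  · intro k i j h
    exact hde j i (h ▸ ht k i)
  · intro i j h
    exact (hdR i j (h ▸ hd1 j)).symm
  · intro k i j h
    exact evR i j _ (ht k i) h



namespace RD
variable {P : PlaneGraph V} {R : ZMod 5 → Finset (Sym2 V)}

/-- the non-spoke edge of `R i` at `t k i` -/
def rho (D : RD P R) (k : Bool) (i : ZMod 5) : Sym2 V :=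
  s(D.t k i, if D.χ (D.d i) = k then D.d i else D.t k (i + 1))

/-- the non-spoke edge of `R i` at `t k (i+1)` -/
def lam (D : RD P R) (k : Bool) (i : ZMod 5) : Sym2 V :=
  s(D.t k (i + 1), if D.χ (D.d i) = k then D.d i else D.t k i)

/-- the spoke -/
def spk (D : RD P R) (k : Bool) (i : ZMod 5) : Sym2 V := s(D.t k i, D.t (!k) i)

lemma tne (D : RD P R) (k : Bool) (i j : ZMod 5) : D.t k i ≠ D.t (!k) j := by
  intro h
  have h1 := D.tχ k i
  rw [h, D.tχ] at h1
  clear h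
  revert h1; revert k; decide

lemma rho_mem (D : RD P R) (k : Bool) (i : ZMod 5) : D.rho k i ∈ R i := by
  unfold rho
  split_ifs with h
  · exact D.e1 k i h
  · exact D.e3 k i h

lemma lam_mem (D : RD P R) (k : Bool) (i : ZMod 5) : D.lam k i ∈ R i := by
  unfold lam
  split_ifs with h
  · exact D.e2 k i h
  · rw [Sym2.eq_swap]; exact D.e3 k i h

lemma rho_ne_spk (D : RD P R) (k : Bool) (i : ZMod 5) : D.rho k i ≠ D.spk k i := by
  unfold rho spk
  intro h
  have h := Sym2.congr_right.1 h
  split_ifs at h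
  · exact D.td _ _ _ h.symm
  · exact D.tne _ _ _ h

lemma lam_ne_spk (D : RD P R) (k : Bool) (i : ZMod 5) : D.lam k i ≠ D.spk k (i + 1) := by
  unfold lam spk
  intro h
  have h := Sym2.congr_right.1 h
  split_ifs at h
  · exact D.td _ _ _ h.symm
  · exact D.tne _ _ _ h

lemma rho_ne_lam (D : RD P R) (k : Bool) (i : ZMod 5) : D.rho k (i + 1) ≠ D.lam k i := by
  have hd : ∀ i : ZMod 5, i + 1 ≠ i ∧ i + 1 + 1 ≠ i := by decide
  unfold rho lam
  intro h
  have h := Sym2.congr_right.1 h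
  split_ifs at h
  · exact (hd i).1 (D.dd _ _ h)
  · exact D.td _ _ _ h.symm
  · exact D.td _ _ _ h
  · exact (hd i).2 (D.tt _ _ _ h)

lemma star_t (D : RD P R) (hP : IsFullerene P) (k : Bool) (i : ZMod 5) :
    star P (D.t k (i + 1)) = {D.spk k (i + 1), D.rho k (i + 1), D.lam k i} := by
  refine star_all hP ?_ ?_ ?_ (D.rho_ne_spk _ _).symm (D.lam_ne_spk _ _).symm (D.rho_ne_lam _ _)
  · exact mem_star.2 ⟨P.face_edges _ (D.face _) _ (D.sp1 k (i + 1)), by simp [spk]⟩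
  · exact mem_star.2 ⟨P.face_edges _ (D.face _) _ (D.rho_mem k (i + 1)), by simp [rho]⟩
  · exact mem_star.2 ⟨P.face_edges _ (D.face _) _ (D.lam_mem k i), by simp [lam]⟩

/-- The third faces at the vertices `t k i`. -/
lemma third (D : RD P R) (hP : IsFullerene P) : ∃ T : Bool → ZMod 5 → Finset (Sym2 V),
    (∀ k i, T k i ∈ P.faces) ∧ (∀ k i, D.rho k i ∈ T k i) ∧ (∀ k i, D.lam k i ∈ T k (i + 1)) ∧
    (∀ k i j, T k i ≠ R j) ∧
    (∀ k i f, f ∈ P.faces → D.t k i ∈ edgeVerts f → (∃ j, f = R j) ∨ f = T k i) := by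
  have ex : ∀ k i, ∃ f, f ∈ P.faces ∧ D.rho k i ∈ f ∧ D.lam k (i - 1) ∈ f := by
    intro k i
    obtain ⟨i, rfl⟩ : ∃ i', i = i' + 1 := ⟨i - 1, by ring⟩
    rw [add_sub_cancel_right]
    have hs := D.star_t hP k i
    obtain ⟨f, hf, h⟩ := corner_face hP (v := D.t k (i + 1)) (a := D.rho k (i + 1))
      (b := D.lam k i) (by rw [hs]; simp) (by rw [hs]; simp) (D.rho_ne_lam k i)
    exact ⟨f, hf, h⟩
  choose T hT h1 h2' using ex
  have h2 : ∀ k i, D.lam k i ∈ T k (i + 1) := fun k i => by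
    have := h2' k (i + 1)
    rwa [add_sub_cancel_right] at this
  refine ⟨T, hT, h1, h2, ?_, ?_⟩
  · intro k i j h
    obtain ⟨i, rfl⟩ : ∃ i', i = i' + 1 := ⟨i - 1, by ring⟩
    have hj : D.spk k (i + 1) ∈ R j := by
      rcases D.tR k (i + 1) j (h ▸ mem_edgeVerts.2 ⟨_, h1 k (i + 1), by simp [rho]⟩) with rfl | h'
      · exact D.sp1 _ _
      · rw [← h']; exact D.sp2 _ _
    exact face_no_three (D.face j) (v := D.t k (i + 1)) hj (h ▸ h1 k (i + 1)) (h ▸ h2 k i)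
      (by simp [spk]) (by simp [rho]) (by simp [lam]) (D.rho_ne_spk _ _).symm
      (D.lam_ne_spk _ _).symm (D.rho_ne_lam _ _)
  · intro k i f hf hv
    obtain ⟨i, rfl⟩ : ∃ i', i = i' + 1 := ⟨i - 1, by ring⟩
    obtain ⟨a, b, hab, ha, hb, va, vb, -⟩ := face_two_edges hf hv
    have ha' := mem_star.2 ⟨P.face_edges _ hf _ ha, va⟩
    have hb' := mem_star.2 ⟨P.face_edges _ hf _ hb, vb⟩
    rw [D.star_t hP] at ha' hb'
    simp only [Finset.mem_insert, Finset.mem_singleton] at ha' hb'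
    have s1 : ∀ g ∈ P.faces, a ∈ g → b ∈ g → f = g := by
      intro g hg hag hbg
      by_contra hne
      exact hab (share_one hP hf hg hne ha hb hag hbg)
    have q1 := D.sp1 k (i + 1)
    have q2 := D.sp2 k i
    have q3 := D.rho_mem k (i + 1)
    have q4 := D.lam_mem k i
    rcases ha' with rfl | rfl | rfl <;> rcases hb' with rfl | rfl | rfl
    · exact (hab rfl).elim
    · exact .inl ⟨_, s1 _ (D.face (i + 1)) q1 q3⟩
    · exact .inl ⟨_, s1 _ (D.face i) q2 q4⟩
    · exact .inl ⟨_, s1 _ (D.face (i + 1)) q3 q1⟩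
    · exact (hab rfl).elim
    · exact .inr (s1 _ (hT _ _) (h1 _ _) (h2 _ _))
    · exact .inl ⟨_, s1 _ (D.face i) q4 q2⟩
    · exact .inr (s1 _ (hT _ _) (h2 _ _) (h1 _ _))
    · exact (hab rfl).elim

end RD

lemma short_cycle {P : PlaneGraph V} {f : Finset (Sym2 V)} (hf : f ∈ P.faces) (X : Finset V)
    (hc : X.card < f.card) (hne : ∃ v ∈ X, v ∈ edgeVerts f)
    (h : ∀ v ∈ X, ∃ x y, x ∈ X ∧ y ∈ X ∧ x ≠ y ∧ s(v, x) ∈ f ∧ s(v, y) ∈ f) : False := by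
  have key : ∀ a b, s(a, b) ∈ f → a ∈ X → b ∈ X := by
    intro a b hab ha
    obtain ⟨x, y, hx, hy, hxy, h1, h2⟩ := h a ha
    by_contra hb
    refine face_no_three hf (v := a) h1 h2 hab (by simp) (by simp) (by simp) ?_ ?_ ?_
    · exact fun h => hxy (Sym2.congr_right.1 h)
    · intro h; rw [← Sym2.congr_right.1 h] at hb; exact hb hx
    · intro h; rw [← Sym2.congr_right.1 h] at hb; exact hb hy
  obtain ⟨v, hvX, hv⟩ := hne
  have : edgeVerts f ⊆ X := by
    intro w hw
    exact face_conn P hf (fun v => v ∈ X)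
      (fun a b hab => ⟨key a b hab, key b a (Sym2.eq_swap ▸ hab)⟩) hv hw hvX
  have := Finset.card_le_card this
  rw [face_card_verts P hf] at this
  omega



namespace RD
variable {P : PlaneGraph V} {R : ZMod 5 → Finset (Sym2 V)}

/-- `T` is the family of third faces. -/
structure IsT (D : RD P R) (T : Bool → ZMod 5 → Finset (Sym2 V)) : Prop where
  face : ∀ k i, T k i ∈ P.faces
  rho : ∀ k i, D.rho k i ∈ T k i
  lam : ∀ k i, D.lam k i ∈ T k (i + 1)
  neR : ∀ k i j, T k i ≠ R j
  uniq : ∀ k i f, f ∈ P.faces → D.t k i ∈ edgeVerts f → (∃ j, f = R j) ∨ f = T k i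

variable {D : RD P R} {T : Bool → ZMod 5 → Finset (Sym2 V)}

lemma IsT.a1 (h : D.IsT T) {k i} (hk : D.χ (D.d i) = k) : s(D.t k i, D.d i) ∈ T k i := by
  have := h.rho k i
  rwa [RD.rho, if_pos hk] at this

lemma IsT.a2 (h : D.IsT T) {k i} (hk : D.χ (D.d i) = k) :
    s(D.t k (i + 1), D.d i) ∈ T k (i + 1) := by
  have := h.lam k i
  rwa [RD.lam, if_pos hk] at this

lemma IsT.a3 (h : D.IsT T) {k i} (hk : D.χ (D.d i) ≠ k) :
    s(D.t k i, D.t k (i + 1)) ∈ T k i := by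
  have := h.rho k i
  rwa [RD.rho, if_neg hk] at this

lemma IsT.a4 (h : D.IsT T) {k i} (hk : D.χ (D.d i) ≠ k) :
    s(D.t k i, D.t k (i + 1)) ∈ T k (i + 1) := by
  have := h.lam k i
  rwa [RD.lam, if_neg hk, Sym2.eq_swap] at this

lemma tt1 (D : RD P R) (k : Bool) (i : ZMod 5) : D.t k i ≠ D.t k (i + 1) := by
  intro h
  have hd : ∀ i : ZMod 5, i ≠ i + 1 := by decide
  exact hd i (D.tt _ _ _ h)

lemma dedge_ne (D : RD P R) (k : Bool) (i : ZMod 5) :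
    s(D.t k i, D.d i) ≠ s(D.t k (i + 1), D.d i) := by
  intro h
  exact D.tt1 k i (Sym2.congr_left.1 h)

lemma IsT.ne (h : D.IsT T) (hP : IsFullerene P) {k i} (hk : D.χ (D.d i) = k) :
    T k i ≠ T k (i + 1) := by
  intro he
  have h1 := h.a1 hk
  have h2 := h.a2 hk
  rw [← he] at h2
  exact D.dedge_ne k i
    (share_one hP (h.face k i) (D.face i) (h.neR _ _ _) h1 h2 (D.e1 k i hk) (D.e2 k i hk))

lemma IsT.eq (h : D.IsT T) {k i} (hk : D.χ (D.d i) ≠ k) : T k i = T k (i + 1) := by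
  rcases edge_third (h.face k (i + 1)) (D.face i) (h.face k i) (h.a4 hk) (D.e3 k i hk) (h.a3 hk)
    (h.neR _ _ _) with h' | h'
  · exact h'
  · exact (h.neR _ _ _ h').elim

lemma IsT.out (h : D.IsT T) (hP : IsFullerene P) {k i} (hk : D.χ (D.d i) = k) :
    ∃ x, D.d i ∈ x ∧ x ∈ T k i ∧ x ∈ T k (i + 1) ∧ x ≠ s(D.t k i, D.d i) ∧
      x ≠ s(D.t k (i + 1), D.d i) := by
  have e1 := D.e1 k i hk
  have e2 := D.e2 k i hk
  obtain ⟨c, hc, hc1, hc2, hall⟩ := star_three hP (v := D.d i)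
    (mem_star.2 ⟨P.face_edges _ (D.face i) _ e1, by simp⟩)
    (mem_star.2 ⟨P.face_edges _ (D.face i) _ e2, by simp⟩) (D.dedge_ne k i)
  have key : ∀ j a, D.d i ∈ a → a ∈ T k j → c ∈ T k j := by
    intro j a ha haT
    obtain ⟨p, q, hpq, hp, hq, vp, vq, -⟩ := face_two_edges (h.face k j)
      (mem_edgeVerts.2 ⟨a, haT, ha⟩)
    have h1 := hall p (mem_star.2 ⟨P.face_edges _ (h.face k j) p hp, vp⟩)
    have h2 := hall q (mem_star.2 ⟨P.face_edges _ (h.face k j) q hq, vq⟩)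
    by_contra hcT
    have hpc : p ≠ c := fun h => hcT (h ▸ hp)
    have hqc : q ≠ c := fun h => hcT (h ▸ hq)
    refine hpq (share_one hP (h.face k j) (D.face i) (h.neR _ _ _) hp hq ?_ ?_)
    · rcases h1 with rfl | rfl | h1
      · exact e1
      · exact e2
      · exact (hpc h1).elim
    · rcases h2 with rfl | rfl | h1
      · exact e1
      · exact e2
      · exact (hqc h1).elim
  exact ⟨c, (mem_star.1 hc).2, key i _ (by simp) (h.a1 hk), key (i + 1) _ (by simp) (h.a2 hk),
    hc1, hc2⟩

lemma five (i : ZMod 5) : i + 1 + 1 + 1 + 1 + 1 = i := by revert i; decide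

lemma IsT.no_one (h : D.IsT T) (hP : IsFullerene P) {k p}
    (hk : ∀ i, D.χ (D.d i) = k ↔ i = p) : False := by
  have hd : ∀ i : ZMod 5, i + 1 ≠ i ∧ i + 1 + 1 ≠ i ∧ i + 1 + 1 + 1 ≠ i ∧ i + 1 + 1 + 1 + 1 ≠ i := by
    decide
  obtain ⟨d1, d2, d3, d4⟩ := hd p
  refine h.ne hP ((hk p).2 rfl) ?_
  rw [h.eq (mt (hk _).1 d1), h.eq (mt (hk _).1 d2), h.eq (mt (hk _).1 d3),
    h.eq (mt (hk _).1 d4), five]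

lemma IsT.two_aux (h : D.IsT T) (hP : IsFullerene P) {k p q} (hpq : p ≠ q)
    (hp : D.χ (D.d p) = k) (hq : D.χ (D.d q) = k) (hA : T k (p + 1) = T k q)
    (hB : T k (q + 1) = T k p) : s(D.d p, D.d q) ∈ T k q := by
  obtain ⟨x, x1, x2, x3, -, -⟩ := h.out hP hp
  obtain ⟨y, y1, y2, y3, -, -⟩ := h.out hP hq
  rw [hA] at x3
  rw [hB] at y3
  have hne : T k q ≠ T k p := by
    have := h.ne hP hp
    rw [hA] at this
    exact this.symm
  have hxy := share_one hP (h.face k q) (h.face k p) hne x3 y2 x2 y3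
  subst hxy
  have : D.d p ≠ D.d q := fun h => hpq (D.dd _ _ h)
  rwa [(Sym2.mem_and_mem_iff this).1 ⟨x1, y1⟩] at x3

lemma IsT.card_ge (h : D.IsT T) (hP : IsFullerene P) (k i) : 5 ≤ (T k i).card := by
  rcases hP.faceSize _ (h.face k i) with h | h <;> omega

lemma IsT.no_two1 (h : D.IsT T) (hP : IsFullerene P) {k p}
    (hk : ∀ i, D.χ (D.d i) = k ↔ i = p ∨ i = p + 1) : False := by
  have hd : ∀ i : ZMod 5, i ≠ i + 1 ∧ ¬ (i + 1 + 1 = i ∨ i + 1 + 1 = i + 1) ∧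
    ¬ (i + 1 + 1 + 1 = i ∨ i + 1 + 1 + 1 = i + 1) ∧
    ¬ (i + 1 + 1 + 1 + 1 = i ∨ i + 1 + 1 + 1 + 1 = i + 1) := by
    decide
  obtain ⟨d1, d2, d3, d4⟩ := hd p
  have hp := (hk p).2 (.inl rfl)
  have hq := (hk (p + 1)).2 (.inr rfl)
  have hx := h.two_aux hP d1 hp hq rfl (by
    rw [h.eq (mt (hk _).1 d2), h.eq (mt (hk _).1 d3), h.eq (mt (hk _).1 d4), five])
  have e1 := h.a2 hp
  have e2 := h.a1 hq
  have n1 := D.td k (p + 1) p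
  have n2 := D.td k (p + 1) (p + 1)
  have n3 : D.d p ≠ D.d (p + 1) := fun h => d1 (D.dd _ _ h)
  refine short_cycle (h.face k (p + 1)) {D.t k (p + 1), D.d p, D.d (p + 1)}
    (lt_of_le_of_lt Finset.card_le_three (by have := h.card_ge hP k (p + 1); omega))
    ⟨D.d p, by simp, mem_edgeVerts.2 ⟨_, e1, by simp⟩⟩ ?_
  intro v hv
  simp only [Finset.mem_insert, Finset.mem_singleton] at hv
  rcases hv with rfl | rfl | rfl
  · exact ⟨D.d p, D.d (p + 1), by simp, by simp, n3, e1, e2⟩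
  · exact ⟨D.t k (p + 1), D.d (p + 1), by simp, by simp, n2, Sym2.eq_swap ▸ e1, hx⟩
  · exact ⟨D.t k (p + 1), D.d p, by simp, by simp, n1, Sym2.eq_swap ▸ e2, Sym2.eq_swap ▸ hx⟩

lemma IsT.no_two2 (h : D.IsT T) (hP : IsFullerene P) {k p}
    (hk : ∀ i, D.χ (D.d i) = k ↔ i = p ∨ i = p + 1 + 1) : False := by
  have hd : ∀ i : ZMod 5, i ≠ i + 1 + 1 ∧ ¬ (i + 1 = i ∨ i + 1 = i + 1 + 1) ∧
    ¬ (i + 1 + 1 + 1 = i ∨ i + 1 + 1 + 1 = i + 1 + 1) ∧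
    ¬ (i + 1 + 1 + 1 + 1 = i ∨ i + 1 + 1 + 1 + 1 = i + 1 + 1) := by
    decide
  obtain ⟨d1, d2, d3, d4⟩ := hd p
  have hp := (hk p).2 (.inl rfl)
  have hq := (hk (p + 1 + 1)).2 (.inr rfl)
  have hA := h.eq (mt (hk _).1 d2)
  have hx := h.two_aux hP d1 hp hq hA (by
    rw [h.eq (mt (hk _).1 d3), h.eq (mt (hk _).1 d4), five])
  have e1 := h.a2 hp
  have e2 := h.a1 hq
  have e3 := h.a3 (mt (hk _).1 d2)
  rw [hA] at e1 e3
  have n1 := D.td k (p + 1) (p + 1 + 1)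
  have n2 := D.td k (p + 1 + 1) p
  have n3 := D.tt1 k (p + 1)
  refine short_cycle (h.face k (p + 1 + 1))
    {D.t k (p + 1), D.t k (p + 1 + 1), D.d p, D.d (p + 1 + 1)}
    (lt_of_le_of_lt Finset.card_le_four (by have := h.card_ge hP k (p + 1 + 1); omega))
    ⟨D.d p, by simp, mem_edgeVerts.2 ⟨_, e1, by simp⟩⟩ ?_
  intro v hv
  simp only [Finset.mem_insert, Finset.mem_singleton] at hv
  rcases hv with rfl | rfl | rfl | rfl
  · exact ⟨D.d p, D.t k (p + 1 + 1), by simp, by simp, n2.symm, e1, e3⟩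
  · exact ⟨D.d (p + 1 + 1), D.t k (p + 1), by simp, by simp, n1.symm, e2, Sym2.eq_swap ▸ e3⟩
  · exact ⟨D.t k (p + 1), D.d (p + 1 + 1), by simp, by simp, n1, Sym2.eq_swap ▸ e1, hx⟩
  · exact ⟨D.t k (p + 1 + 1), D.d p, by simp, by simp, n2, Sym2.eq_swap ▸ e2, Sym2.eq_swap ▸ hx⟩

lemma IsT.all_same (h : D.IsT T) (hP : IsFullerene P) : ∃ k, ∀ i, D.χ (D.d i) = k := by
  have key : ∀ s : ZMod 5 → Bool, (∃ k, ∀ i, s i = k) ∨ (∃ k p, ∀ i, s i = k ↔ i = p) ∨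
      (∃ k p, ∀ i, s i = k ↔ i = p ∨ i = p + 1) ∨
      (∃ k p, ∀ i, s i = k ↔ i = p ∨ i = p + 1 + 1) := by
    change ∀ s : Fin 5 → Bool, (∃ k, ∀ i, s i = k) ∨ (∃ k, ∃ p : Fin 5, ∀ i, s i = k ↔ i = p) ∨
      (∃ k, ∃ p : Fin 5, ∀ i, s i = k ↔ i = p ∨ i = p + 1) ∨
      (∃ k, ∃ p : Fin 5, ∀ i, s i = k ↔ i = p ∨ i = p + 1 + 1)
    decide
  rcases key (fun i => D.χ (D.d i)) with h1 | ⟨k, p, h1⟩ | ⟨k, p, h1⟩ | ⟨k, p, h1⟩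
  · exact h1
  · exact (h.no_one hP h1).elim
  · exact (h.no_two1 hP h1).elim
  · exact (h.no_two2 hP h1).elim

end RD

lemma indep_cases (J : ZMod 5 → Prop) (h : ∀ i, J i → ¬ J (i + 1)) :
    (∃ i, J i ∧ J (i + 2)) ∨ (∃ i, ∀ j, J j → j = i) := by
  classical
  have key : ∀ s : ZMod 5 → Bool, (∀ i, s i = true → ¬ s (i + 1) = true) →
      (∃ i, s i = true ∧ s (i + 2) = true) ∨ (∃ i, ∀ j, s j = true → j = i) := by
    change ∀ s : Fin 5 → Bool, (∀ i : Fin 5, s i = true → ¬ s (i + 1) = true) →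
      (∃ i : Fin 5, s i = true ∧ s (i + 2) = true) ∨ (∃ i : Fin 5, ∀ j, s j = true → j = i)
    decide
  have := key (fun i => decide (J i)) (by intro i; simpa using h i)
  simpa using this



lemma matching_chain {M : Finset (Sym2 V)} (hM : IsMatching M) {C : Finset V}
    (hav : ∀ e ∈ M, ∀ v : V, v ∈ e → v ∉ C) (w b d : ZMod 5 → V)
    (hwb : ∀ i j, w i ≠ b j) (hww : ∀ i j, w i = w j → i = j)
    (mw : ∀ j j', j' = j + 1 → w j' ∉ C →
      s(w j', b j') ∈ M ∨ s(w j', d j') ∈ M ∨ s(w j', d j) ∈ M)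
    (mb : ∀ j j' j'', j' = j + 1 → j'' = j' + 1 →
      s(b j', w j') ∈ M ∨ s(b j', b j'') ∈ M ∨ s(b j', b j) ∈ M)
    (i : ZMod 5) (w0 : w i ∈ C) (w2 : w (i + 2) ∈ C)
    (w1 : w (i + 1) ∉ C) (w3 : w (i + 3) ∉ C) (w4 : w (i + 4) ∉ C)
    (d0 : d i ∈ C) (d1 : d (i + 1) ∈ C) (d2 : d (i + 2) ∈ C) (d4 : d (i + 4) ∈ C) : False := by
  have conf : ∀ v x y, s(v, x) ∈ M → s(v, y) ∈ M → x = y := by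
    intro v x y hx hy
    by_contra hne
    exact hM.2 _ hx _ hy (fun h => hne (Sym2.congr_right.1 h)) v (by simp) (by simp)
  have av : ∀ x y, s(x, y) ∈ M → y ∉ C := fun x y h => hav _ h y (by simp)
  have sw : ∀ x y, s(x, y) ∈ M → s(y, x) ∈ M := fun x y h => Sym2.eq_swap ▸ h
  have m1 : s(w (i + 1), b (i + 1)) ∈ M := by
    rcases mw i (i + 1) rfl w1 with h | h | h
    · exact h
    · exact (av _ _ h d1).elim
    · exact (av _ _ h d0).elim
  have m2 : s(b i, b (i + 4)) ∈ M := by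
    rcases mb (i + 4) i (i + 1) (by clear * -; revert i; decide) rfl with h | h | h
    · exact (av _ _ h w0).elim
    · exact (hwb _ _ (conf _ _ _ (sw _ _ m1) (sw _ _ h))).elim
    · exact h
  have m3 : s(b (i + 2), b (i + 3)) ∈ M := by
    rcases mb (i + 1) (i + 2) (i + 3) (by ring) (by ring) with h | h | h
    · exact (av _ _ h w2).elim
    · exact h
    · exact (hwb _ _ (conf _ _ _ (sw _ _ m1) (sw _ _ h))).elim
  have m4 : s(w (i + 3), d (i + 3)) ∈ M := by
    rcases mw (i + 2) (i + 3) (by ring) w3 with h | h | h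
    · exact (hwb _ _ (conf _ _ _ (sw _ _ h) (sw _ _ m3))).elim
    · exact h
    · exact (av _ _ h d2).elim
  rcases mw (i + 3) (i + 4) (by ring) w4 with h | h | h
  · exact hwb _ _ (conf _ _ _ (sw _ _ h) (sw _ _ m2))
  · exact av _ _ h d4
  · have := hww _ _ (conf _ _ _ (sw _ _ h) (sw _ _ m4))
    exact absurd this (by clear * -; revert i; decide)

lemma mem_ring {R : ZMod 5 → Finset (Sym2 V)} {e : Sym2 V} :
    e ∈ (Finset.univ : Finset (ZMod 5)).sup R ↔ ∃ i, e ∈ R i := by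
  simp [Finset.mem_sup]

lemma mem_facesVerts {H : Finset (Finset (Sym2 V))} {v : V} :
    v ∈ facesVerts H ↔ ∃ f ∈ H, v ∈ edgeVerts f := by
  simp only [facesVerts, mem_edgeVerts, Finset.mem_sup, id]
  constructor
  · rintro ⟨e, ⟨f, hf, he⟩, hv⟩
    exact ⟨f, hf, e, he, hv⟩
  · rintro ⟨f, hf, e, he, hv⟩
    exact ⟨e, ⟨f, hf, he⟩, hv⟩

lemma count_twelve (U : Finset V) (w b d : ZMod 5 → V)
    (hwb : ∀ i j, w i ≠ b j) (hww : ∀ i j, w i = w j → i = j) (hbb : ∀ i j, b i = b j → i = j)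
    (hdd : ∀ i j, d i = d j → i = j) (hwd : ∀ i j, w i ≠ d j) (hbd : ∀ i j, b i ≠ d j)
    (i : ZMod 5) (hb : ∀ j, b j ∈ U) (hw : ∀ j, j ≠ i → w j ∈ U)
    (hd : ∀ j, j ≠ i → j + 1 ≠ i → d j ∈ U) : 12 ≤ U.card := by
  have c1 : (Finset.univ.image b).card = 5 := by
    rw [Finset.card_image_of_injective _ (fun x y h => hbb x y h)]; rfl
  have c2 : ((Finset.univ.filter fun j => j ≠ i).image w).card = 4 := by
    rw [Finset.card_image_of_injective _ (fun x y h => hww x y h)]; clear * -; revert i; decide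
  have c3 : ((Finset.univ.filter fun j => j ≠ i ∧ j + 1 ≠ i).image d).card = 3 := by
    rw [Finset.card_image_of_injective _ (fun x y h => hdd x y h)]; clear * -; revert i; decide
  have D1 : Disjoint (Finset.univ.image b) ((Finset.univ.filter fun j => j ≠ i).image w) := by
    rw [Finset.disjoint_left]
    intro x hx hy
    simp only [Finset.mem_image] at hx hy
    obtain ⟨p, -, rfl⟩ := hx
    obtain ⟨q, -, hq⟩ := hy
    exact hwb _ _ hq
  have D2 : Disjoint (Finset.univ.image b ∪ (Finset.univ.filter fun j => j ≠ i).image w)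
      ((Finset.univ.filter fun j => j ≠ i ∧ j + 1 ≠ i).image d) := by
    rw [Finset.disjoint_left]
    intro x hx hy
    simp only [Finset.mem_union, Finset.mem_image] at hx hy
    obtain ⟨q, -, rfl⟩ := hy
    rcases hx with ⟨p, -, hp⟩ | ⟨p, -, hp⟩
    · exact hbd _ _ hp
    · exact hwd _ _ hp
  have := Finset.card_union_of_disjoint D2
  rw [Finset.card_union_of_disjoint D1, c1, c2, c3] at this
  have h12 : (5 + 4 + 3 : ℕ) = 12 := rfl
  rw [← h12, ← this]
  apply Finset.card_le_card
  intro x hx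
  simp only [Finset.mem_union, Finset.mem_image, Finset.mem_filter, Finset.mem_univ,
    true_and] at hx
  rcases hx with (⟨p, rfl⟩ | ⟨p, hp, rfl⟩) | ⟨p, hp, rfl⟩
  · exact hb p
  · exact hw p hp
  · exact hd p hp.1 hp.2

lemma main_bound {P : PlaneGraph V} (hP : IsFullerene P)
    {R : ZMod 5 → Finset (Sym2 V)} (hR : IsPentRing P 5 R)
    {H : Finset (Finset (Sym2 V))}
    (hH : SextetAdm P ((Finset.univ : Finset (ZMod 5)).sup R) H) :
    12 ≤ (Uset ((Finset.univ : Finset (ZMod 5)).sup R) H).card := by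
  obtain ⟨D⟩ := ring_struct hP hR
  obtain ⟨T, t1, t2, t3, t4, t5⟩ := D.third hP
  have hT : D.IsT T := ⟨t1, t2, t3, t4, t5⟩
  obtain ⟨k, hk⟩ := hT.all_same hP
  obtain ⟨hF, hdisj, M, hME, hM, hav, hcov⟩ := hH
  have hk' : ∀ i, D.χ (D.d i) ≠ !k := by
    intro i; rw [hk i]; clear * -; revert k; decide
  have tcov : ∀ κ i, D.t κ i ∈ facesVerts H → T κ i ∈ H := by
    intro κ i h
    obtain ⟨f, hf, hv⟩ := mem_facesVerts.1 h
    rcases hT.uniq κ i f (hF f hf).1 hv with ⟨j, hj⟩ | hj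
    · have h6 := (hF f hf).2.1
      rw [hj, D.card j] at h6
      omega
    · exact hj ▸ hf
  have bnot : ∀ i, D.t (!k) i ∉ facesVerts H := by
    intro i h
    have h6 := (hF _ (tcov _ _ h)).2.1
    have e : ∀ j, T (!k) j = T (!k) (j + 1) := fun j => hT.eq (hk' j)
    have hall : ∀ j, T (!k) j = T (!k) i := by
      have e0 : ∀ j j', j' = j + 1 → T (!k) j' = T (!k) j := by
        rintro j j' rfl; exact (e j).symm
      have a1 := e0 i (i + 1) rfl
      have a2 := e0 (i + 1) (i + 2) (by ring)
      have a3 := e0 (i + 2) (i + 3) (by ring)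
      have a4 := e0 (i + 3) (i + 4) (by ring)
      intro j
      have hj : ∀ i j : ZMod 5, j = i ∨ j = i + 1 ∨ j = i + 2 ∨ j = i + 3 ∨ j = i + 4 := by decide
      rcases hj i j with rfl | rfl | rfl | rfl | rfl
      · rfl
      · exact a1
      · exact a2.trans a1
      · exact a3.trans (a2.trans a1)
      · exact a4.trans (a3.trans (a2.trans a1))
    have hedge : ∀ j, s(D.t (!k) j, D.t (!k) (j + 1)) ∈ T (!k) i := by
      intro j
      rw [← hall j]
      exact hT.a3 (hk' j)
    refine short_cycle (hT.face (!k) i) (Finset.univ.image (D.t (!k))) ?_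
      ⟨D.t (!k) i, by simp, mem_edgeVerts.2 ⟨_, hedge i, by simp⟩⟩ ?_
    · rw [h6]
      exact lt_of_le_of_lt Finset.card_image_le (by decide)
    · intro v hv
      simp only [Finset.mem_image, Finset.mem_univ, true_and] at hv
      obtain ⟨j, rfl⟩ := hv
      refine ⟨D.t (!k) (j + 1), D.t (!k) (j - 1), by simp, by simp, ?_, hedge j, ?_⟩
      · intro h
        have := D.tt _ _ _ h
        revert this
        clear * -
        revert j
        decide
      · have := hedge (j - 1)
        rw [sub_add_cancel] at this
        exact Sym2.eq_swap ▸ this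
  have dcov : ∀ i, D.d i ∈ facesVerts H → T k i ∈ H ∨ T k (i + 1) ∈ H := by
    intro i h
    obtain ⟨f, hf, hv⟩ := mem_facesVerts.1 h
    have e1 := D.e1 k i (hk i)
    have e2 := D.e2 k i (hk i)
    have hne : ∀ j, f ≠ R j := by
      intro j hj
      have h6 := (hF f hf).2.1
      rw [hj, D.card j] at h6
      omega
    obtain ⟨e, hef, heR, hde⟩ := faces_share hP (hF f hf).1 (D.face i) hv
      (mem_edgeVerts.2 ⟨_, e1, by simp⟩)
    by_cases h1 : e = s(D.t k i, D.d i)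
    · left
      rcases hT.uniq k i f (hF f hf).1 (mem_edgeVerts.2 ⟨e, hef, by simp [h1]⟩) with ⟨j, hj⟩ | hj
      · exact (hne j hj).elim
      · exact hj ▸ hf
    by_cases h2 : e = s(D.t k (i + 1), D.d i)
    · right
      rcases hT.uniq k (i + 1) f (hF f hf).1 (mem_edgeVerts.2 ⟨e, hef, by simp [h2]⟩) with
        ⟨j, hj⟩ | hj
      · exact (hne j hj).elim
      · exact hj ▸ hf
    exact (face_no_three (D.face i) e1 e2 heR (by simp) (by simp) hde (D.dedge_ne k i)
      (Ne.symm h1) (Ne.symm h2)).elim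
  have hJ : ∀ i, T k i ∈ H → ¬ T k (i + 1) ∈ H := by
    intro i h1 h2
    exact Finset.disjoint_left.1 (hdisj _ h1 _ h2 (hT.ne hP (hk i)))
      (mem_edgeVerts.2 ⟨_, hT.a1 (hk i), by simp⟩ : D.d i ∈ _)
      (mem_edgeVerts.2 ⟨_, hT.a2 (hk i), by simp⟩)
  have tE : ∀ κ i, D.t κ i ∈ edgeVerts ((Finset.univ : Finset (ZMod 5)).sup R) := fun κ i =>
    mem_edgeVerts.2 ⟨_, mem_ring.2 ⟨i, D.sp1 κ i⟩, by simp⟩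
  have dE : ∀ i, D.d i ∈ edgeVerts ((Finset.univ : Finset (ZMod 5)).sup R) := fun i =>
    mem_edgeVerts.2 ⟨_, mem_ring.2 ⟨i, D.e1 k i (hk i)⟩, by simp⟩
  have hwb : ∀ i j, D.t k i ≠ D.t (!k) j := fun i j => D.tne k i j
  rcases indep_cases (fun i => T k i ∈ H) hJ with ⟨i, hi, hi2⟩ | ⟨i, hi⟩
  · exfalso
    have tm : ∀ κ j, D.t κ (j + 1) ∉ facesVerts H →
        D.spk κ (j + 1) ∈ M ∨ D.rho κ (j + 1) ∈ M ∨ D.lam κ j ∈ M := by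
      intro κ j h
      have hs := D.star_t hP κ j
      have hdeg : deg ((Finset.univ : Finset (ZMod 5)).sup R) (D.t κ (j + 1)) = 3 := by
        rw [← star_card hP (D.t κ (j + 1)), deg]
        congr 1
        ext e
        constructor
        · intro he
          rw [Finset.mem_filter, mem_ring] at he
          obtain ⟨⟨p, hp⟩, hv⟩ := he
          exact mem_star.2 ⟨P.face_edges _ (D.face p) _ hp, hv⟩
        · intro he
          rw [Finset.mem_filter, mem_ring]
          refine ⟨?_, (mem_star.1 he).2⟩
          rw [hs] at he
          simp only [Finset.mem_insert, Finset.mem_singleton] at he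
          rcases he with rfl | rfl | rfl
          · exact ⟨_, D.sp1 κ (j + 1)⟩
          · exact ⟨_, D.rho_mem κ (j + 1)⟩
          · exact ⟨_, D.lam_mem κ j⟩
      obtain ⟨e, he, hv⟩ := hcov _ (tE κ (j + 1)) hdeg h
      obtain ⟨p, hp⟩ := mem_ring.1 (hME he)
      have hst : e ∈ star P (D.t κ (j + 1)) := mem_star.2 ⟨P.face_edges _ (D.face p) _ hp, hv⟩
      rw [hs] at hst
      simp only [Finset.mem_insert, Finset.mem_singleton] at hst
      rcases hst with rfl | rfl | rfl
      · exact .inl he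
      · exact .inr (.inl he)
      · exact .inr (.inr he)
    have i5 : i + 4 + 1 = i := by clear * -; revert i; decide
    have dc0 : ∀ j, T k j ∈ H → D.d j ∈ facesVerts H := fun j h =>
      mem_facesVerts.2 ⟨_, h, mem_edgeVerts.2 ⟨_, hT.a1 (hk j), by simp⟩⟩
    have dc1 : ∀ j, T k (j + 1) ∈ H → D.d j ∈ facesVerts H := fun j h =>
      mem_facesVerts.2 ⟨_, h, mem_edgeVerts.2 ⟨_, hT.a2 (hk j), by simp⟩⟩
    have tc : ∀ j, T k j ∈ H → D.t k j ∈ facesVerts H := fun j h =>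
      mem_facesVerts.2 ⟨_, h, mem_edgeVerts.2 ⟨_, hT.a1 (hk j), by simp⟩⟩
    refine matching_chain hM hav (D.t k) (D.t (!k)) D.d hwb (D.tt k) ?_ ?_ i (tc _ hi) (tc _ hi2)
      ?_ ?_ ?_ (dc0 _ hi) (dc1 _ ?_) (dc0 _ hi2) (dc1 _ ?_)
    · rintro j j' rfl hc
      have := tm k j hc
      rwa [RD.spk, RD.rho, RD.lam, if_pos (hk _), if_pos (hk _)] at this
    · rintro j j' j'' rfl rfl
      have := tm (!k) j (bnot _)
      rwa [RD.spk, RD.rho, RD.lam, if_neg (hk' _), if_neg (hk' _), Bool.not_not] at this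
    · exact fun h => hJ i hi (tcov _ _ h)
    · intro h
      have h3 : i + 2 + 1 = i + 3 := by ring
      exact hJ (i + 2) hi2 (h3 ▸ tcov _ _ h)
    · intro h
      exact hJ (i + 4) (tcov _ _ h) (i5.symm ▸ hi)
    · have h3 : i + 1 + 1 = i + 2 := by ring
      exact h3.symm ▸ hi2
    · exact i5.symm ▸ hi
  · refine count_twelve _ (D.t k) (D.t (!k)) D.d hwb (D.tt k) (D.tt (!k)) D.dd (D.td k)
      (D.td (!k)) i ?_ ?_ ?_
    · exact fun j => Finset.mem_sdiff.2 ⟨tE _ _, bnot j⟩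
    · exact fun j hj => Finset.mem_sdiff.2 ⟨tE _ _, fun h => hj (hi j (tcov _ _ h))⟩
    · intro j h1 h2
      refine Finset.mem_sdiff.2 ⟨dE _, fun h => ?_⟩
      rcases dcov j h with h | h
      · exact h1 (hi _ h)
      · exact h2 (hi _ h)


/-- Observation 1. Let `R_5` be a pentagonal ring of five pentagons in
a fullerene graph `F` and `H` a Clar set of `H[R_5]`. Then `|U_H(R_5)| ≥ 12`. -/
theorem statement_5 (P : PlaneGraph V) (hP : IsFullerene P)
    (R : ZMod 5 → Finset (Sym2 V)) (hR : IsPentRing P 5 R)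
    (H : Finset (Finset (Sym2 V)))
    (hH : IsClarSet P ((Finset.univ : Finset (ZMod 5)).sup R) H) :
    12 ≤ (Uset ((Finset.univ : Finset (ZMod 5)).sup R) H).card := by
  exact main_bound hP hR hH.1

end FG
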